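/- arXiv:math/0701114 — 4 statements merged into one kernel-verified Lean document; each statement's English description precedes it below -/
import Mathlib

section
/- Let $v_1,\ldots,v_n \in \mathbb{R}^n$ be linearly independent vectors and let $s \in \mathbb{R}_+^n$ lie in the interior of the convex cone generated by $v_1,\ldots,v_n$, so that $s = \sum_{j=1}^n \sigma_j v_j$ with all $\sigma_j > 0$. For $a \in \mathbb{R}_+^n$, define $E_v^a := \{x \in \mathbb{R}^n : \sum_{i=1}^n a_i^{-1} |x|^{v_i} \leq 1\}$, where $|x|^{v} := \prod_j |x_j|^{v_j}$. Then $\int_{E_v^a} \prod_{j=1}^n |x_j|^{s_j - 1}\, dx = 2^n \frac{a^\sigma}{V} \frac{\prod_{j=1}^n \Gamma(\sigma_j)}{\Gamma(1 + \sigma_1 + \cdots + \sigma_n)}$, where $V$ is the absolute value of the determinant of the matrix with columns $v_1,\ldots,v_n$ and $a^\sigma := \prod_i a_i^{\sigma_i}$. -/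
open MeasureTheory Real

lemma aux_succ {n : ℕ} (F : (Fin (n+1) → ℝ) → ENNReal) (hF : Measurable F) :
    ∫⁻ x, F x = ∫⁻ a : ℝ, ∫⁻ y : Fin n → ℝ, F (Fin.cons a y) := by
  have h := (volume_preserving_piFinSuccAbove (fun _ : Fin (n+1) => ℝ) 0).symm
  rw [← h.lintegral_comp hF, Measure.volume_eq_prod, lintegral_prod]
  · simp [MeasurableEquiv.piFinSuccAbove_symm_apply, Fin.insertNthEquiv]
  · exact (hF.comp (MeasurableEquiv.measurable _)).aemeasurable

lemma aux_exp (g : ℝ → ENNReal) :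
    ∫⁻ x in Set.Ioi 0, g x = ∫⁻ t, ENNReal.ofReal (exp t) * g (exp t) := by
  have := lintegral_image_eq_lintegral_abs_deriv_mul (f := exp) (f' := exp) MeasurableSet.univ
    (fun x _ => (Real.hasDerivAt_exp x).hasDerivWithinAt) Real.exp_injective.injOn g
  simpa [Set.image_univ, Real.range_exp] using this

lemma aux_abs (g : ℝ → ENNReal) (hg : Measurable g) :
    ∫⁻ x, g |x| = 2 * ∫⁻ t, ENNReal.ofReal (exp t) * g (exp t) := by
  rw [← aux_exp, ← lintegral_add_compl _ (measurableSet_Ioi (a := (0:ℝ))), two_mul]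
  congr 1
  · exact setLIntegral_congr_fun measurableSet_Ioi (fun x hx => by rw [abs_of_pos hx])
  · rw [Set.compl_Ioi, setLIntegral_congr Iio_ae_eq_Iic.symm]
    have h := (Measure.measurePreserving_neg (volume : Measure ℝ)).setLIntegral_comp_preimage
      (measurableSet_Ioi (a := (0:ℝ))) hg
    rw [← h]
    have : (Neg.neg ⁻¹' Set.Ioi (0:ℝ)) = Set.Iio 0 := by ext; simp
    rw [this]
    exact setLIntegral_congr_fun measurableSet_Iio (fun x hx => by rw [abs_of_neg hx])

lemma aux_absexp (n : ℕ) (F : (Fin n → ℝ) → ENNReal) (hF : Measurable F) :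
    ∫⁻ x : Fin n → ℝ, F (fun i => |x i|) =
      2 ^ n * ∫⁻ t : Fin n → ℝ, ENNReal.ofReal (exp (∑ i, t i)) * F (fun i => exp (t i)) := by
  induction n with
  | zero =>
    simp
    congr 1
    ext x
    congr 1
    ext i
    exact i.elim0
  | succ n ih =>
    rw [aux_succ _ (by fun_prop), aux_succ _ (by fun_prop)]
    have hc : Measurable (fun p : ℝ × (Fin n → ℝ) => (Fin.cons p.1 p.2 : Fin (n+1) → ℝ)) := by
      refine measurable_pi_lambda _ (fun i => ?_)
      refine Fin.cases ?_ (fun j => ?_) i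
      · simpa using measurable_fst
      · simp only [Fin.cons_succ]
        fun_prop
    have e1 : ∀ (a : ℝ) (y : Fin n → ℝ), (fun i => |(Fin.cons a y : Fin (n+1) → ℝ) i|)
        = Fin.cons |a| (fun i => |y i|) := by
      intro a y; ext i; refine Fin.cases ?_ (fun j => ?_) i <;> simp
    have e2 : ∀ (a : ℝ) (y : Fin n → ℝ), (fun i => exp ((Fin.cons a y : Fin (n+1) → ℝ) i))
        = Fin.cons (exp a) (fun i => exp (y i)) := by
      intro a y; ext i; refine Fin.cases ?_ (fun j => ?_) i <;> simp
    simp_rw [e1, e2]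
    have hm : ∀ r : ℝ, Measurable (fun y : Fin n → ℝ => F (Fin.cons r y)) := fun r =>
      hF.comp (hc.comp (measurable_const.prodMk measurable_id))
    have hG : Measurable (fun r : ℝ => ∫⁻ t : Fin n → ℝ, ENNReal.ofReal (exp (∑ i, t i)) *
        F (Fin.cons r (fun i => exp (t i)))) := by
      apply Measurable.lintegral_prod_right' (f := fun p : ℝ × (Fin n → ℝ) =>
        ENNReal.ofReal (exp (∑ i, p.2 i)) * F (Fin.cons p.1 (fun i => exp (p.2 i))))
      apply Measurable.mul (by fun_prop)
      exact hF.comp (hc.comp (f := fun p : ℝ × (Fin n → ℝ) => (p.1, fun i => exp (p.2 i))) (by fun_prop))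
    have step : ∀ a : ℝ, ∫⁻ y : Fin n → ℝ, F (Fin.cons |a| (fun i => |y i|)) = 
        2 ^ n * ∫⁻ t : Fin n → ℝ, ENNReal.ofReal (exp (∑ i, t i)) *
        F (Fin.cons |a| (fun i => exp (t i))) := fun a => ih _ (hm _)
    simp_rw [step]
    rw [lintegral_const_mul' _ _ (by finiteness), aux_abs _ hG, pow_succ, mul_assoc]
    congr 2
    refine lintegral_congr (fun a => ?_)
    rw [← lintegral_const_mul' _ _ (by finiteness)]
    refine lintegral_congr (fun y => ?_)
    simp only [Fin.sum_univ_succ, Fin.cons_zero, Fin.cons_succ]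
    rw [Real.exp_add, ENNReal.ofReal_mul (exp_pos _).le, mul_assoc]

lemma aux_prod (n : ℕ) (f : Fin n → ℝ → ENNReal) (hf : ∀ i, Measurable (f i)) :
    ∫⁻ x : Fin n → ℝ, ∏ i, f i (x i) = ∏ i, ∫⁻ t, f i t := by
  induction n with
  | zero => simp [volume_pi]
  | succ n ih =>
    rw [aux_succ (fun x => ∏ i, f i (x i))
      (Finset.measurable_prod _ (fun i _ => (hf i).comp (measurable_pi_apply i)))]
    simp_rw [Fin.prod_univ_succ, Fin.cons_zero, Fin.cons_succ]
    rw [← ih _ (fun i => hf i.succ), ← lintegral_mul_const _ (hf 0)]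
    refine lintegral_congr (fun a => ?_)
    rw [lintegral_const_mul]
    exact (Finset.measurable_prod _ (fun i _ => (hf _).comp (measurable_pi_apply i)))

lemma aux_gamma (σ : ℝ) (hσ : 0 < σ) :
    ∫⁻ t, ENNReal.ofReal (exp (σ * t - exp t)) = ENNReal.ofReal (Gamma σ) := by
  rw [Real.Gamma_eq_integral hσ, ofReal_integral_eq_lintegral_ofReal
    (Real.GammaIntegral_convergent hσ), aux_exp]
  · refine lintegral_congr (fun t => ?_)
    rw [← ENNReal.ofReal_mul (exp_pos _).le, ← Real.exp_mul, ← Real.exp_add, ← Real.exp_add]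
    congr 2; ring
  · filter_upwards [ae_restrict_mem measurableSet_Ioi] with x hx
    have : (0:ℝ) < x := hx
    simp only [Pi.zero_apply]; positivity

lemma aux_tail (r : ℝ) (hr : 0 < r) :
    ∫⁻ t, (if r ≤ exp t then ENNReal.ofReal (exp (t - exp t)) else 0)
      = ENNReal.ofReal (exp (-r)) := by
  rw [← integral_exp_neg_Ioi, ofReal_integral_eq_lintegral_ofReal (integrableOn_exp_neg_Ioi r)
    (Filter.Eventually.of_forall fun x => (exp_pos _).le), setLIntegral_congr Ioi_ae_eq_Ici]
  have := aux_exp ((Set.Ici r).indicator fun x => ENNReal.ofReal (exp (-x)))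
  rw [lintegral_indicator measurableSet_Ici, Measure.restrict_restrict measurableSet_Ici,
    Set.inter_eq_left.2 (Set.Ici_subset_Ioi.2 hr)] at this
  rw [this]
  refine lintegral_congr (fun t => ?_)
  by_cases h : r ≤ exp t
  · rw [if_pos h, Set.indicator_of_mem (by exact h), ← ENNReal.ofReal_mul (exp_pos _).le, ← Real.exp_add,
      sub_eq_add_neg]
  · rw [if_neg h, Set.indicator_of_notMem (by exact h), mul_zero]

noncomputable def dirI (n : ℕ) (σ : Fin n → ℝ) : ENNReal :=
  ∫⁻ u : Fin n → ℝ, if ∑ i, exp (u i) ≤ 1 then ENNReal.ofReal (exp (∑ i, σ i * u i)) else 0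

lemma aux_dir (n : ℕ) (hn : 0 < n) (σ : Fin n → ℝ) (hσ : ∀ j, 0 < σ j) :
    dirI n σ * ENNReal.ofReal (Gamma (1 + ∑ i, σ i)) = ENNReal.ofReal (∏ i, Gamma (σ i)) := by
  have hS : 0 < 1 + ∑ i, σ i := by
    have : 0 ≤ ∑ i, σ i := Finset.sum_nonneg (fun i _ => (hσ i).le)
    linarith
  have : Nonempty (Fin n) := ⟨⟨0, hn⟩⟩
  have swap := lintegral_lintegral_swap (μ := (volume : Measure (Fin n → ℝ)))
    (ν := (volume : Measure ℝ))
    (f := fun u t => if ∑ i, exp (u i) ≤ exp t then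
      ENNReal.ofReal (exp (t - exp t)) * ENNReal.ofReal (exp (∑ i, σ i * u i)) else 0) (by
      apply Measurable.aemeasurable
      apply Measurable.ite (measurableSet_le (by fun_prop) (by fun_prop)) <;> fun_prop)
  have L : ∀ u : Fin n → ℝ, ∫⁻ t : ℝ, (if ∑ i, exp (u i) ≤ exp t then
      ENNReal.ofReal (exp (t - exp t)) * ENNReal.ofReal (exp (∑ i, σ i * u i)) else 0)
      = ∏ i, ENNReal.ofReal (exp (σ i * u i - exp (u i))) := by
    intro u
    have h1 := aux_tail (∑ i, exp (u i)) (Finset.sum_pos (fun i _ => exp_pos _) Finset.univ_nonempty)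
    calc _ = ∫⁻ t : ℝ, (if ∑ i, exp (u i) ≤ exp t then
      ENNReal.ofReal (exp (t - exp t)) else 0) * ENNReal.ofReal (exp (∑ i, σ i * u i)) := by
          simp only [ite_mul, zero_mul]
      _ = _ := by
        rw [lintegral_mul_const' _ _ (by finiteness), h1, ← ENNReal.ofReal_mul (exp_pos _).le,
          ← ENNReal.ofReal_prod_of_nonneg (fun i _ => (exp_pos _).le), ← Real.exp_add,
          ← Real.exp_sum, Finset.sum_sub_distrib]
        congr 2; ring
  have R : ∀ t : ℝ, ∫⁻ u : Fin n → ℝ, (if ∑ i, exp (u i) ≤ exp t then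
      ENNReal.ofReal (exp (t - exp t)) * ENNReal.ofReal (exp (∑ i, σ i * u i)) else 0)
      = dirI n σ * ENNReal.ofReal (exp ((1 + ∑ i, σ i) * t - exp t)) := by
    intro t
    rw [dirI, ← lintegral_mul_const' _ _ (by finiteness),
      ← lintegral_add_right_eq_self _ (fun _ => t)]
    refine lintegral_congr (fun u => ?_)
    have : (∑ i, exp ((u + fun _ : Fin n => t) i) ≤ exp t) ↔ (∑ i, exp (u i) ≤ 1) := by
      simp only [Pi.add_apply, Real.exp_add, ← Finset.sum_mul]
      exact mul_le_iff_le_one_left (exp_pos t)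
    rw [ite_mul, zero_mul]
    refine if_congr this ?_ rfl
    rw [← ENNReal.ofReal_mul (exp_pos _).le, ← ENNReal.ofReal_mul (exp_pos _).le, ← Real.exp_add,
      ← Real.exp_add]
    simp only [Pi.add_apply, mul_add, Finset.sum_add_distrib, ← Finset.sum_mul]
    congr 2; ring
  simp_rw [L, R] at swap
  rw [aux_prod n (fun i t => ENNReal.ofReal (exp (σ i * t - exp t))) (fun i => by fun_prop),
    lintegral_const_mul _ (by fun_prop), aux_gamma _ hS] at swap
  rw [← swap, ENNReal.ofReal_prod_of_nonneg (fun i _ => (Gamma_pos_of_pos (hσ i)).le)]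
  exact Finset.prod_congr rfl (fun i _ => aux_gamma _ (hσ i))

lemma aux_lin (n : ℕ) (v : Fin n → Fin n → ℝ) (hd : (Matrix.of v).det ≠ 0)
    (a : Fin n → ℝ) (ha : ∀ i, 0 < a i) (σ s : Fin n → ℝ) (hsv : s = ∑ j, σ j • v j) :
    ∫⁻ t : Fin n → ℝ, (if ∑ i, (a i)⁻¹ * exp (∑ j, v i j * t j) ≤ 1 then
      ENNReal.ofReal (exp (∑ j, s j * t j)) else 0) =
    ENNReal.ofReal (|(Matrix.of v).det|⁻¹ * ∏ i, a i ^ σ i) * dirI n σ := by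
  set G : (Fin n → ℝ) → ENNReal := fun w => if ∑ i, (a i)⁻¹ * exp (w i) ≤ 1 then
      ENNReal.ofReal (exp (∑ j, σ j * w j)) else 0 with hG
  have hGm : Measurable G := by
    apply Measurable.ite (measurableSet_le (by fun_prop) (by fun_prop)) <;> fun_prop
  have h1 : ∫⁻ t : Fin n → ℝ, (if ∑ i, (a i)⁻¹ * exp (∑ j, v i j * t j) ≤ 1 then
      ENNReal.ofReal (exp (∑ j, s j * t j)) else 0) = 
      ∫⁻ w, G w ∂(Measure.map (Matrix.toLin' (Matrix.of v)) volume) := by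
    rw [lintegral_map hGm (LinearMap.continuous_on_pi _).measurable]
    refine lintegral_congr (fun t => ?_)
    have : ∑ j, s j * t j = ∑ j, σ j * ∑ k, v j k * t k := by
      simp only [hsv, Finset.sum_apply, Pi.smul_apply, smul_eq_mul, Finset.sum_mul, Finset.mul_sum]
      rw [Finset.sum_comm]
      simp only [mul_assoc]
    simp only [hG, this, Matrix.toLin'_apply, Matrix.mulVec, dotProduct, Matrix.of_apply]
    congr 1
  rw [h1, Real.map_matrix_volume_pi_eq_smul_volume_pi hd, lintegral_smul_measure,
    ENNReal.ofReal_mul (by positivity), abs_inv, smul_eq_mul, mul_assoc]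
  congr 1
  rw [dirI, ← lintegral_const_mul' _ _ (by finiteness),
    ← lintegral_add_right_eq_self _ (fun i => log (a i))]
  refine lintegral_congr (fun u => ?_)
  simp only [hG, Pi.add_apply, mul_ite, mul_zero]
  have e : ∀ i, (a i)⁻¹ * exp (u i + log (a i)) = exp (u i) := by
    intro i
    have := (ha i).ne'
    rw [Real.exp_add, Real.exp_log (ha i)]; field_simp
  simp only [e]
  congr 1
  have : ∏ i, a i ^ σ i = exp (∑ i, σ i * log (a i)) := by
    rw [Real.exp_sum]
    refine Finset.prod_congr rfl (fun i _ => ?_)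
    rw [Real.rpow_def_of_pos (ha i), mul_comm]
  rw [this, ← ENNReal.ofReal_mul (exp_pos _).le, ← Real.exp_add]
  simp only [mul_add, Finset.sum_add_distrib]
  congr 2; ring

/-- Volume of the generalized "ball" `E_v^a` with respect to the monomial-weight
measure `|·|_s`, with the sharp Gamma-function constant. -/
theorem stmt_0 (n : ℕ) (hn : 0 < n) (v : Fin n → Fin n → ℝ)
    (hv : LinearIndependent ℝ v)
    (σ : Fin n → ℝ) (hσ : ∀ j, 0 < σ j)
    (s : Fin n → ℝ) (hs : ∀ i, 0 < s i)
    (hsv : s = ∑ j, σ j • v j)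
    (a : Fin n → ℝ) (ha : ∀ i, 0 < a i) :
    ∫ x in {x : Fin n → ℝ | ∑ i, (a i)⁻¹ * ∏ j, |x j| ^ (v i j) ≤ 1},
        ∏ j, |x j| ^ (s j - 1)
      = 2 ^ n * (∏ i, a i ^ σ i) / |(Matrix.of fun i j => v j i).det|
          * (∏ j, Real.Gamma (σ j)) / Real.Gamma (1 + ∑ j, σ j) := by
  have hd : (Matrix.of v).det ≠ 0 := by
    have := (Matrix.linearIndependent_rows_iff_isUnit (A := Matrix.of v)).1 hv
    exact ((Matrix.isUnit_iff_isUnit_det _).1 this).ne_zero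
  have hdt : (Matrix.of fun i j => v j i).det = (Matrix.of v).det :=
    Matrix.det_transpose (Matrix.of v)
  have hS : 0 < 1 + ∑ i, σ i := by
    have : 0 ≤ ∑ i, σ i := Finset.sum_nonneg (fun i _ => (hσ i).le)
    linarith
  have hms : MeasurableSet {x : Fin n → ℝ | ∑ i, (a i)⁻¹ * ∏ j, |x j| ^ (v i j) ≤ 1} :=
    measurableSet_le (by fun_prop) (by fun_prop)
  have hmf : Measurable (fun x : Fin n → ℝ => ∏ j, |x j| ^ (s j - 1)) := by fun_prop
  rw [integral_eq_lintegral_of_nonneg_ae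
    (Filter.Eventually.of_forall fun x => Finset.prod_nonneg fun j _ => by positivity)
    hmf.aestronglyMeasurable, ← lintegral_indicator hms]
  set F : (Fin n → ℝ) → ENNReal := fun x => if ∑ i, (a i)⁻¹ * ∏ j, (x j) ^ (v i j) ≤ 1 then
    ENNReal.ofReal (∏ j, (x j) ^ (s j - 1)) else 0 with hF
  have hFm : Measurable F := by
    apply Measurable.ite (measurableSet_le (by fun_prop) (by fun_prop)) <;> fun_prop
  have h1 : (∫⁻ x, ({x : Fin n → ℝ | ∑ i, (a i)⁻¹ * ∏ j, |x j| ^ (v i j) ≤ 1}.indicator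
      (fun x => ENNReal.ofReal (∏ j, |x j| ^ (s j - 1)))) x) = ∫⁻ x : Fin n → ℝ, F (fun i => |x i|) := by
    refine lintegral_congr (fun x => ?_)
    simp only [hF, Set.indicator_apply, Set.mem_ofPred_eq]
  rw [h1, aux_absexp n F hFm]
  have h2 : ∫⁻ t : Fin n → ℝ, ENNReal.ofReal (exp (∑ i, t i)) * F (fun i => exp (t i)) =
    ∫⁻ t : Fin n → ℝ, (if ∑ i, (a i)⁻¹ * exp (∑ j, v i j * t j) ≤ 1 then
      ENNReal.ofReal (exp (∑ j, s j * t j)) else 0) := by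
    refine lintegral_congr (fun t => ?_)
    simp only [hF, mul_ite, mul_zero, ← Real.exp_mul, ← Real.exp_sum,
      ← ENNReal.ofReal_mul (exp_pos _).le, ← Real.exp_add, ← Finset.sum_add_distrib]
    have e1 : ∀ i, ∑ j, t j * v i j = ∑ j, v i j * t j := fun i =>
      Finset.sum_congr rfl (fun j _ => mul_comm _ _)
    have e2 : ∑ j, (t j + t j * (s j - 1)) = ∑ j, s j * t j :=
      Finset.sum_congr rfl (fun j _ => by ring)
    simp only [e1, e2]
  rw [h2, aux_lin n v hd a ha σ s hsv, hdt]
  have h3 := congrArg ENNReal.toReal (aux_dir n hn σ hσ)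
  have hG := Gamma_pos_of_pos hS
  rw [ENNReal.toReal_mul, ENNReal.toReal_ofReal hG.le, ENNReal.toReal_ofReal
    (Finset.prod_nonneg fun i _ => (Gamma_pos_of_pos (hσ i)).le)] at h3
  rw [ENNReal.toReal_mul, ENNReal.toReal_mul, ENNReal.toReal_ofReal (mul_nonneg (by positivity)
    (Finset.prod_nonneg fun i _ => (rpow_pos_of_pos (ha i) _).le)), ← h3]
  have := hG.ne'
  have := abs_ne_zero.2 hd
  simp only [ENNReal.toReal_pow, ENNReal.toReal_ofNat]
  field_simp
end

section
/- Let $w_1,\ldots,w_N \in \mathbb{R}_+^n$ with $N \geq n$, and suppose some $n$-element subfamily of the $w_j$ is linearly independent. Let $\theta_0, \theta_1, \ldots, \theta_N$ be positive reals with $\sum_{j=0}^N \theta_j = 1$, and set $s := \sum_{j=1}^N \theta_j w_j$. Then there exists a constant $C < \infty$ such that for every measurable set $E \subset \mathbb{R}^n$, $|E|_s \leq C \prod_{j=1}^N |E|_{w_j}^{\theta_j}$. -/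
open MeasureTheory Real ENNReal

/-- The monomial-weight measure `|E|_w = ∫_E ∏ |x_i|^{w_i - 1} dx`. -/
noncomputable def wtMeasure {n : ℕ} (w : Fin n → ℝ) (E : Set (Fin n → ℝ)) : ℝ≥0∞ :=
  ∫⁻ x in E, ∏ i, ENNReal.ofReal (|x i| ^ (w i - 1))

/-- Pointwise scalar inequality. -/
lemma scalar_ineq {n N : ℕ} (g : Fin n → Fin N) (hg : Function.Injective g)
    (θ : Fin N → ℝ) (hθ : ∀ j, 0 < θ j) (hsum : ∑ j, θ j ≤ 1) (δ : ℝ) (hδ : ∀ j, δ ≤ θ j)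
    (y : Fin N → ℝ) :
    exp (∑ j, θ j * y j) ≤ ∑ j, exp (y j) + exp (-(δ * ∑ i, |y (g i)|)) := by
  by_cases h : ∀ j, y j < 0
  · have h1 : ∑ j, θ j * y j ≤ ∑ j ∈ Finset.univ.map ⟨g, hg⟩, θ j * y j := by
      have := Finset.sum_le_sum_of_subset_of_nonneg (f := fun j => -(θ j * y j))
        (Finset.subset_univ (Finset.univ.map ⟨g, hg⟩))
        (fun j _ _ => by nlinarith [hθ j, h j])
      simp only [Finset.sum_neg_distrib] at this
      linarith
    rw [Finset.sum_map] at h1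
    have h2 : ∑ i, θ (g i) * y (g i) ≤ -(δ * ∑ i, |y (g i)|) := by
      rw [Finset.mul_sum, ← Finset.sum_neg_distrib]
      refine Finset.sum_le_sum fun i _ => ?_
      rw [abs_of_neg (h _)]
      nlinarith [hδ (g i), h (g i)]
    have h3 : 0 ≤ ∑ j, exp (y j) := Finset.sum_nonneg fun j _ => (exp_pos _).le
    have h4 := exp_le_exp.2 (h1.trans h2)
    linarith
  · push Not at h
    obtain ⟨j0, hj0⟩ := h
    obtain ⟨m, _, hm⟩ := Finset.exists_max_image Finset.univ y ⟨j0, Finset.mem_univ _⟩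
    have hm0 : 0 ≤ y m := hj0.trans (hm j0 (Finset.mem_univ _))
    have h1 : ∑ j, θ j * y j ≤ y m := by
      calc ∑ j, θ j * y j ≤ ∑ j, θ j * y m :=
            Finset.sum_le_sum fun j hj => mul_le_mul_of_nonneg_left (hm j hj) (hθ j).le
        _ = (∑ j, θ j) * y m := by rw [Finset.sum_mul]
        _ ≤ y m := by nlinarith
    have h2 : exp (y m) ≤ ∑ j, exp (y j) :=
      Finset.single_le_sum (f := fun j => exp (y j)) (fun j _ => (exp_pos _).le) (Finset.mem_univ m)
    have h3 := exp_le_exp.2 h1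
    have h4 := exp_pos (-(δ * ∑ i, |y (g i)|))
    linarith

lemma lint_exp_abs (c : ℝ) (hc : 0 < c) :
    ∫⁻ t : ℝ, ENNReal.ofReal (exp (-(c * |t|))) < ⊤ := by
  have h1 : IntegrableOn (fun x : ℝ => exp (-(c * |x|))) (Set.Ioi 0) := by
    refine (integrableOn_exp_mul_Ioi (neg_lt_zero.2 hc) 0).congr_fun ?_ measurableSet_Ioi
    intro x hx
    simp only [abs_of_pos (Set.mem_Ioi.1 hx), neg_mul]
  have h2 : IntegrableOn (fun x : ℝ => exp (-(c * |x|))) (Set.Iic 0) := by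
    refine (integrableOn_exp_mul_Iic hc 0).congr_fun ?_ measurableSet_Iic
    intro x hx
    simp only [abs_of_nonpos (Set.mem_Iic.1 hx)]
    congr 1; ring
  have h3 : Integrable (fun x : ℝ => exp (-(c * |x|))) := by
    rw [← integrableOn_univ, ← Set.Iic_union_Ioi (a := (0 : ℝ))]
    exact h2.union h1
  have := h3.lintegral_lt_top
  exact this

lemma lint_one (c b : ℝ) :
    ∫⁻ x : ℝ, ENNReal.ofReal (exp (-log |x| - c * |log |x| - b|))
      = 2 * ∫⁻ t : ℝ, ENNReal.ofReal (exp (-(c * |t|))) := by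
  set f : ℝ → ℝ≥0∞ := fun x => ENNReal.ofReal (exp (-log |x| - c * |log |x| - b|)) with hf
  have key : ∫⁻ x in Set.Ioi (0:ℝ), f x = ∫⁻ t : ℝ, ENNReal.ofReal (exp (-(c * |t|))) := by
    have h := lintegral_image_eq_lintegral_abs_deriv_mul (f := exp) (f' := exp) (s := Set.univ)
      MeasurableSet.univ (fun x _ => (Real.hasDerivAt_exp x).hasDerivWithinAt)
      (Real.exp_injective.injOn) f
    rw [Set.image_univ, Real.range_exp, Measure.restrict_univ] at h
    rw [h, ← lintegral_sub_right_eq_self (fun t : ℝ => ENNReal.ofReal (exp (-(c * |t|)))) b]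
    refine lintegral_congr fun t => ?_
    simp only [hf, abs_exp, log_exp]
    rw [← ENNReal.ofReal_mul (exp_pos _).le, ← exp_add]
    congr 2; ring
  have key2 : ∫⁻ x in Set.Iic (0:ℝ), f x = ∫⁻ x in Set.Ioi (0:ℝ), f x := by
    rw [← setLIntegral_congr (Iio_ae_eq_Iic (a := (0:ℝ)) (μ := volume))]
    have h := (Measure.measurePreserving_neg (volume : Measure ℝ)).setLIntegral_comp_preimage_emb
      (MeasurableEquiv.neg ℝ).measurableEmbedding f (Set.Ioi 0)
    rw [← h]
    simp [hf]
  rw [← lintegral_add_compl f measurableSet_Ioi (A := Set.Ioi (0:ℝ)), Set.compl_Ioi, key2, key, two_mul]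

lemma lint_prod {n : ℕ} (c : ℝ) (hc : 0 < c) (b : Fin n → ℝ) :
    ∫⁻ x : Fin n → ℝ, ENNReal.ofReal (∏ k, exp (-log |x k| - c * |log |x k| - b k|))
      = (2 * ∫⁻ t : ℝ, ENNReal.ofReal (exp (-(c * |t|)))) ^ n := by
  have hi : ∀ k, Integrable (fun x : ℝ => exp (-log |x| - c * |log |x| - b k|)) := by
    intro k
    refine ⟨(by fun_prop : Measurable _).aestronglyMeasurable, ?_⟩
    rw [hasFiniteIntegral_iff_ofReal (Filter.Eventually.of_forall fun _ => (exp_pos _).le),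
      lint_one]
    exact ENNReal.mul_lt_top (by simp) (lint_exp_abs c hc)
  rw [← ofReal_integral_eq_lintegral_ofReal]
  · rw [volume_pi, integral_fintype_prod_eq_prod
      (f := fun (k : Fin n) (x : ℝ) => exp (-log |x| - c * |log |x| - b k|)),
      ENNReal.ofReal_prod_of_nonneg]
    · rw [Finset.prod_congr rfl (g := fun _ => (2 * ∫⁻ t : ℝ, ENNReal.ofReal (exp (-(c * |t|)))))]
      · simp
      · intro k _
        rw [ofReal_integral_eq_lintegral_ofReal (hi k)
          (Filter.Eventually.of_forall fun _ => (exp_pos _).le), lint_one]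
    · intro k _
      exact integral_nonneg fun _ => (exp_pos _).le
  · exact Integrable.fintype_prod hi
  · exact Filter.Eventually.of_forall fun _ => Finset.prod_nonneg fun _ _ => (exp_pos _).le

lemma exists_inv {n : ℕ} (W : Fin n → Fin n → ℝ) (hW : LinearIndependent ℝ W) :
    ∃ K : ℝ, 0 < K ∧ ∀ a : Fin n → ℝ, ∃ b : Fin n → ℝ, ∀ l : Fin n → ℝ,
      ∑ k, |l k - b k| ≤ K * ∑ i, |∑ k, W i k * l k - a i| := by
  let M : Matrix (Fin n) (Fin n) ℝ := Matrix.of W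
  have hu : IsUnit M := Matrix.linearIndependent_rows_iff_isUnit.1 hW
  have hd : IsUnit M.det := (Matrix.isUnit_iff_isUnit_det _).1 hu
  refine ⟨∑ k, ∑ i, |M⁻¹ k i| + 1, ?_, fun a => ⟨M⁻¹.mulVec a, fun l => ?_⟩⟩
  · have : 0 ≤ ∑ k, ∑ i, |M⁻¹ k i| :=
      Finset.sum_nonneg fun _ _ => Finset.sum_nonneg fun _ _ => abs_nonneg _
    linarith
  · set z : Fin n → ℝ := M.mulVec l - a with hz
    have h1 : l - M⁻¹.mulVec a = M⁻¹.mulVec z := by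
      rw [hz, Matrix.mulVec_sub, Matrix.mulVec_mulVec, Matrix.nonsing_inv_mul _ hd,
        Matrix.one_mulVec]
    have hz' : ∀ i, ∑ k, W i k * l k - a i = z i := fun i => rfl
    simp only [hz']
    have hS : 0 ≤ ∑ i, |z i| := Finset.sum_nonneg fun _ _ => abs_nonneg _
    have h2 : ∀ k, |l k - M⁻¹.mulVec a k| ≤ (∑ i, |M⁻¹ k i|) * ∑ i, |z i| := by
      intro k
      have : l k - M⁻¹.mulVec a k = ∑ i, M⁻¹ k i * z i := congrFun h1 k
      rw [this]
      refine (Finset.abs_sum_le_sum_abs _ _).trans ?_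
      rw [Finset.sum_mul]
      refine Finset.sum_le_sum fun i _ => ?_
      rw [abs_mul]
      exact mul_le_mul_of_nonneg_left
        (Finset.single_le_sum (f := fun i => |z i|) (fun _ _ => abs_nonneg _) (Finset.mem_univ i))
        (abs_nonneg _)
    calc _ ≤ ∑ k, (∑ i, |M⁻¹ k i|) * ∑ i, |z i| := Finset.sum_le_sum fun k _ => h2 k
      _ = (∑ k, ∑ i, |M⁻¹ k i|) * ∑ i, |z i| := by rw [Finset.sum_mul]
      _ ≤ _ := by nlinarith

lemma dens_eq {n : ℕ} (w x : Fin n → ℝ) (hx : ∀ i, x i ≠ 0) :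
    ∏ i, ENNReal.ofReal (|x i| ^ (w i - 1))
      = ENNReal.ofReal (exp (∑ i, w i * log |x i| - ∑ i, log |x i|)) := by
  rw [← ENNReal.ofReal_prod_of_nonneg (fun i _ => by positivity), ← Finset.sum_sub_distrib, exp_sum]
  congr 1
  refine Finset.prod_congr rfl fun i _ => ?_
  rw [rpow_def_of_pos (abs_pos.2 (hx i))]
  congr 1; ring

lemma ae_ne {n : ℕ} : ∀ᵐ x : Fin n → ℝ, ∀ i, x i ≠ 0 := by
  rw [ae_all_iff]
  intro i
  exact Measure.ae_eval_ne (μ := fun _ : Fin n => (volume : Measure ℝ)) i 0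

lemma dens_meas {n : ℕ} (w : Fin n → ℝ) :
    Measurable fun x : Fin n → ℝ => ∏ i, ENNReal.ofReal (|x i| ^ (w i - 1)) := by
  fun_prop

lemma null_of_wt {n : ℕ} (w s : Fin n → ℝ) (E : Set (Fin n → ℝ)) (hE : MeasurableSet E)
    (h : wtMeasure w E = 0) : wtMeasure s E = 0 := by
  unfold wtMeasure at h
  rw [setLIntegral_eq_zero_iff hE (dens_meas w)] at h
  have hv : volume E = 0 := by
    have : ∀ᵐ x : Fin n → ℝ, x ∉ E := by
      filter_upwards [h, ae_ne] with x hx hx0 hxE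
      have := hx hxE
      rw [dens_eq w x hx0] at this
      simp only [ENNReal.ofReal_eq_zero] at this
      exact absurd this (not_le.2 (exp_pos _))
    simpa [ae_iff] using this
  exact setLIntegral_measure_zero _ _ hv

/-- Interpolation inequality for monomial-weight measures: many weights, some
`n` of which are linearly independent, with total interpolation weight `< 1`. -/
theorem stmt_3 (n N : ℕ) (hn : 0 < n) (hnN : n ≤ N)
    (w : Fin N → Fin n → ℝ) (hwpos : ∀ j i, 0 < w j i)
    (hind : ∃ g : Fin n → Fin N, Function.Injective g ∧ LinearIndependent ℝ (w ∘ g))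
    (θ0 : ℝ) (θ : Fin N → ℝ) (hθ0 : 0 < θ0) (hθ : ∀ j, 0 < θ j)
    (hsum : θ0 + ∑ j, θ j = 1)
    (s : Fin n → ℝ) (hs : s = ∑ j, θ j • w j) :
    ∃ C : ℝ≥0∞, C < ⊤ ∧ ∀ E : Set (Fin n → ℝ), MeasurableSet E →
      wtMeasure s E ≤ C * ∏ j, (wtMeasure (w j) E) ^ (θ j) := by
  obtain ⟨g, hg, hli⟩ := hind
  obtain ⟨K, hK, hinv⟩ := exists_inv _ hli
  obtain ⟨m, _, hm⟩ := Finset.exists_min_image Finset.univ θ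
    ⟨(⟨0, by omega⟩ : Fin N), Finset.mem_univ _⟩
  set c : ℝ := θ m / K with hc
  have hc0 : 0 < c := div_pos (hθ m) hK
  set L : ℝ≥0∞ := (2 * ∫⁻ t : ℝ, ENNReal.ofReal (exp (-(c * |t|)))) ^ n with hL
  have hLtop : L < ⊤ := ENNReal.pow_lt_top (ENNReal.mul_lt_top (by simp) (lint_exp_abs c hc0))
  refine ⟨N + L, ENNReal.add_lt_top.2 ⟨by simp, hLtop⟩, fun E hE => ?_⟩
  by_cases h0 : ∃ j, wtMeasure (w j) E = 0
  · obtain ⟨j, hj⟩ := h0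
    rw [null_of_wt (w j) s E hE hj]
    exact zero_le
  push Not at h0
  by_cases ht : ∃ j, wtMeasure (w j) E = ⊤
  · obtain ⟨j, hj⟩ := ht
    have : ∏ j, (wtMeasure (w j) E) ^ (θ j) = ⊤ := by
      rw [← Finset.mul_prod_erase _ _ (Finset.mem_univ j), hj, ENNReal.top_rpow_of_pos (hθ j)]
      refine ENNReal.top_mul (Finset.prod_ne_zero_iff.2 fun i _ => ?_)
      simp [ENNReal.rpow_eq_zero_iff, h0 i, (hθ i).le, not_lt.2 (hθ i).le]
    rw [this, ENNReal.mul_top]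
    · exact le_top
    · have : (N : ℝ≥0∞) ≠ 0 := by
        simp; omega
      simp [this]
  push Not at ht
  let a : Fin N → ℝ := fun j => log (wtMeasure (w j) E).toReal
  have ha : ∀ j, wtMeasure (w j) E = ENNReal.ofReal (exp (a j)) := fun j => by
    simp only [a]
    rw [exp_log (ENNReal.toReal_pos (h0 j) (ht j)), ENNReal.ofReal_toReal (ht j)]
  have hP : ∏ j, (wtMeasure (w j) E) ^ (θ j) = ENNReal.ofReal (exp (∑ j, θ j * a j)) := by
    rw [exp_sum, ENNReal.ofReal_prod_of_nonneg (fun _ _ => (exp_pos _).le)]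
    refine Finset.prod_congr rfl fun j _ => ?_
    rw [ha j, ENNReal.ofReal_rpow_of_pos (exp_pos _), ← exp_mul, mul_comm]
  obtain ⟨b, hb⟩ := hinv (fun i => a (g i))
  have hpt : ∀ x : Fin n → ℝ, (∀ i, x i ≠ 0) →
      ∏ i, ENNReal.ofReal (|x i| ^ (s i - 1)) ≤
        (∑ j, (∏ i, ENNReal.ofReal (|x i| ^ (w j i - 1))) * ENNReal.ofReal (exp (-a j))
          + ENNReal.ofReal (∏ k, exp (-log |x k| - c * |log |x k| - b k|)))
          * ENNReal.ofReal (exp (∑ j, θ j * a j)) := by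
    intro x hx
    simp only [dens_eq _ x hx]
    set l : Fin n → ℝ := fun k => log |x k| with hl
    have hl' : ∀ k, log |x k| = l k := fun k => rfl
    simp only [hl']
    simp only [← ENNReal.ofReal_mul (exp_pos _).le]
    rw [← ENNReal.ofReal_sum_of_nonneg (fun _ _ => by positivity),
      ← ENNReal.ofReal_add (Finset.sum_nonneg fun _ _ => by positivity)
        (Finset.prod_nonneg fun _ _ => by positivity),
      ← ENNReal.ofReal_mul (add_nonneg (Finset.sum_nonneg fun _ _ => by positivity)
        (Finset.prod_nonneg fun _ _ => by positivity))]
    apply ENNReal.ofReal_le_ofReal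
    have hS := scalar_ineq g hg θ hθ (by linarith) (θ m) (fun j => hm j (Finset.mem_univ _))
      (fun j => ∑ k, w j k * l k - a j)
    have hbl : c * ∑ k, |l k - b k| ≤ θ m * ∑ i, |∑ k, w (g i) k * l k - a (g i)| := by
      have h := mul_le_mul_of_nonneg_left (hb l) hc0.le
      have hcK : c * K = θ m := by rw [hc]; field_simp
      rw [← mul_assoc, hcK] at h
      exact h
    have h5 := hS.trans (add_le_add_right (exp_le_exp.2 (neg_le_neg hbl)) _)
    have hsl : ∑ i, s i * l i = ∑ j, θ j * ∑ k, w j k * l k := by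
      simp only [hs, Finset.sum_apply, Pi.smul_apply, smul_eq_mul, Finset.sum_mul, Finset.mul_sum]
      rw [Finset.sum_comm]
      simp only [mul_assoc]
    have h6 := mul_le_mul_of_nonneg_right h5
      (exp_pos (∑ j, θ j * a j - ∑ i, l i)).le
    rw [← exp_add] at h6
    have e1 : exp (∑ i, s i * l i - ∑ i, l i)
        = exp (∑ j, θ j * (∑ k, w j k * l k - a j) + (∑ j, θ j * a j - ∑ i, l i)) := by
      congr 1
      rw [hsl]
      simp only [mul_sub, Finset.sum_sub_distrib]
      ring
    have e2 : (∑ j, exp (∑ i, w j i * l i - ∑ i, l i) * exp (-a j)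
          + ∏ k, exp (-l k - c * |l k - b k|)) * exp (∑ j, θ j * a j)
        = (∑ j, exp (∑ k, w j k * l k - a j) + exp (-(c * ∑ k, |l k - b k|)))
          * exp (∑ j, θ j * a j - ∑ i, l i) := by
      rw [sub_eq_neg_add (∑ j, θ j * a j), exp_add (-∑ i, l i), ← mul_assoc]
      congr 1
      rw [add_mul, Finset.sum_mul]
      congr 1
      · refine Finset.sum_congr rfl fun j _ => ?_
        rw [← exp_add, ← exp_add]
        congr 1; ring
      · rw [← exp_sum, ← exp_add]
        congr 1
        rw [Finset.sum_sub_distrib, Finset.mul_sum, Finset.sum_neg_distrib]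
        ring
    rw [← e1, ← e2] at h6
    exact h6
  rw [hP]
  have hmeas : ∀ j, Measurable fun x : Fin n → ℝ =>
      (∏ i, ENNReal.ofReal (|x i| ^ (w j i - 1))) * ENNReal.ofReal (exp (-a j)) :=
    fun j => (dens_meas (w j)).mul_const _
  calc wtMeasure s E
      ≤ ∫⁻ x in E, (∑ j, (∏ i, ENNReal.ofReal (|x i| ^ (w j i - 1))) * ENNReal.ofReal (exp (-a j))
          + ENNReal.ofReal (∏ k, exp (-log |x k| - c * |log |x k| - b k|)))
          * ENNReal.ofReal (exp (∑ j, θ j * a j)) := by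
        refine lintegral_mono_ae ?_
        filter_upwards [ae_restrict_of_ae ae_ne] with x hx using hpt x hx
    _ = (∑ j, wtMeasure (w j) E * ENNReal.ofReal (exp (-a j))
          + ∫⁻ x in E, ENNReal.ofReal (∏ k, exp (-log |x k| - c * |log |x k| - b k|)))
          * ENNReal.ofReal (exp (∑ j, θ j * a j)) := by
        rw [lintegral_mul_const' _ _ ENNReal.ofReal_ne_top,
          lintegral_add_left (Finset.measurable_sum _ fun j _ => hmeas j),
          lintegral_finsetSum _ fun j _ => hmeas j]
        simp only [lintegral_mul_const' _ _ ENNReal.ofReal_ne_top]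
        rfl
    _ ≤ (N + L) * ENNReal.ofReal (exp (∑ j, θ j * a j)) := by
        gcongr
        · refine le_of_eq ?_
          rw [Finset.sum_congr rfl (g := fun _ => (1 : ℝ≥0∞))]
          · simp
          · intro j _
            rw [ha j, ← ENNReal.ofReal_mul (exp_pos _).le, ← exp_add]
            simp
        · exact (setLIntegral_le_lintegral _ _).trans (lint_prod c hc0 b).le
end

section
/- Fix an integer $k \geq 1$. There exists a constant $c_k > 0$ such that the following holds: for every interval $I \subset \mathbb{R}$, every $f \in C^k(I)$ with $f^{(k)}(t) \geq 1$ on $I$, and every measurable set $E \subset I$, one has $\int_E |f(t)|\, dt \geq c_k \int_{S(E)} \frac{|t|^k}{k!}\, dt$, where $S(E) := \{t \in \mathbb{R} : |t| < |E|/2\}$ is the symmetric interval of the same Lebesgue measure as $E$. One may take $c_k = 2^k \frac{j_0!(k-j_0)!}{k^k (k+1)^k}$ with $j_0 = \lfloor (k+1)/2 \rfloor$. -/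
open MeasureTheory

lemma aux_rolle (I : Set ℝ) (hI : I.OrdConnected) (hu : UniqueDiffOn ℝ I) :
    ∀ (k : ℕ) (g : ℝ → ℝ) (t : ℕ → ℝ), ContDiffOn ℝ k g I → (∀ i ≤ k, t i ∈ I) →
      (∀ i < k, t i < t (i + 1)) → (∀ i ≤ k, g (t i) = 0) →
      ∃ ξ ∈ I, iteratedDerivWithin k g I ξ = 0 := by
  intro k
  induction k with
  | zero =>
    intro g t _ ht _ h0
    exact ⟨t 0, ht 0 le_rfl, by simpa using h0 0 le_rfl⟩
  | succ k ih =>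
    intro g t hg ht hlt h0
    have hg' : ContDiffOn ℝ k (derivWithin g I) I := by
      apply hg.derivWithin hu
      push_cast
      exact le_rfl
    have key : ∀ i, ∃ c, i ≤ k → (t i < c ∧ c < t (i + 1) ∧ derivWithin g I c = 0) := by
      intro i
      by_cases hi : i ≤ k
      swap
      · exact ⟨0, fun h => absurd h hi⟩
      have hsub : Set.Icc (t i) (t (i+1)) ⊆ I := hI.out (ht i (by omega)) (ht (i+1) (by omega))
      obtain ⟨c, hc, hc0⟩ := exists_hasDerivAt_eq_zero (f := g) (f' := derivWithin g I)
        (hlt i (by omega)) (hg.continuousOn.mono hsub)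
        (by rw [h0 i (by omega), h0 (i+1) (by omega)]) (by
          intro x hx
          have hn : I ∈ nhds x := Filter.mem_of_superset (Icc_mem_nhds hx.1 hx.2) hsub
          have hd : DifferentiableWithinAt ℝ g I x :=
            (hg.differentiableOn (by simp)) x (mem_of_mem_nhds hn)
          exact hd.hasDerivWithinAt.hasDerivAt hn)
      exact ⟨c, fun _ => ⟨hc.1, hc.2, hc0⟩⟩
    choose c hc using key
    obtain ⟨ξ, hξ, h⟩ := ih (derivWithin g I) c hg'
      (fun i hi => hI.out (ht i (by omega)) (ht (i+1) (by omega))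
        ⟨(hc i hi).1.le, (hc i hi).2.1.le⟩)
      (fun i hi => ((hc i (by omega)).2.1).trans (hc (i+1) (by omega)).1)
      (fun i hi => (hc i hi).2.2)
    exact ⟨ξ, hξ, by rw [iteratedDerivWithin_succ']; exact h⟩

lemma aux_divdiff (I : Set ℝ) (hI : I.OrdConnected) (hu : UniqueDiffOn ℝ I)
    (k : ℕ) (f : ℝ → ℝ) (t : ℕ → ℝ) (hf : ContDiffOn ℝ k f I) (ht : ∀ i ≤ k, t i ∈ I)
    (hlt : ∀ i < k, t i < t (i + 1)) (hinj : Set.InjOn t (Finset.range (k+1)))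
    (hd : ∀ x ∈ I, 1 ≤ iteratedDerivWithin k f I x) :
    1 ≤ (k.factorial : ℝ) * ∑ i ∈ Finset.range (k+1),
      f (t i) / ∏ j ∈ (Finset.range (k+1)).erase i, (t i - t j) := by
  set s := Finset.range (k+1) with hs
  set P := Lagrange.interpolate s t (fun i => f (t i)) with hP
  have hdeg : P.degree < s.card := Lagrange.degree_interpolate_lt _ hinj
  have hPe : ∀ i ∈ s, P.eval (t i) = f (t i) := fun i hi =>
    Lagrange.eval_interpolate_at_node _ hinj hi
  have hPc : ContDiff ℝ k (fun x => P.eval x) := by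
    simpa using P.contDiff_aeval (𝕜 := ℝ) (R := ℝ) (k : WithTop ℕ∞)
  obtain ⟨ξ, hξ, h⟩ := aux_rolle I hI hu k (f - fun x => P.eval x) t
    (hf.sub hPc.contDiffOn) ht hlt (by
      intro i hi
      simp [hPe i (Finset.mem_range.2 (by omega))])
  rw [iteratedDerivWithin_sub hξ hu (hf ξ hξ) hPc.contDiffAt.contDiffWithinAt,
    iteratedDerivWithin_eq_iteratedDeriv hu hPc.contDiffAt hξ, iteratedDeriv_eq_iterate] at h
  have hit : ∀ (n : ℕ) (Q : Polynomial ℝ), deriv^[n] (fun x => Q.eval x)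
      = fun x => (Polynomial.derivative^[n] Q).eval x := by
    intro n
    induction n with
    | zero => intro Q; rfl
    | succ n ih =>
      intro Q
      rw [Function.iterate_succ_apply, Function.iterate_succ_apply, ← ih]
      congr 1
      ext x
      exact Q.deriv
  rw [hit] at h
  have h2 := Lagrange.eval_iterate_derivative_eq_sum hinj hdeg (k := k) (by simp [hs]) ξ
  have h3 := hd ξ hξ
  have h4 : (s.card - (k+1)) = 0 := by simp [hs]
  simp only [h4, Finset.powersetCard_zero, Finset.sum_singleton, Finset.prod_empty, mul_one] at h2
  rw [Finset.sum_congr rfl (fun i hi => by rw [hPe i hi])] at h2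
  rw [← h2]
  linarith

lemma aux_prod_s9 (j d : ℕ) :
    ∏ i ∈ (Finset.range (j + d + 1)).erase j, |(j:ℝ) - i| = j.factorial * d.factorial := by
  induction d with
  | zero =>
    have : (Finset.range (j + 0 + 1)).erase j = Finset.range j := by
      ext x; simp; omega
    rw [this, Nat.factorial_zero, Nat.cast_one, mul_one]
    rw [← Finset.prod_range_add_one_eq_factorial, ← Finset.prod_range_reflect]
    push_cast
    apply Finset.prod_congr rfl
    intro i hi
    have hi := Finset.mem_range.1 hi
    have : ((j - 1 - i : ℕ) : ℝ) = j - 1 - i := by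
      rw [Nat.cast_sub (by omega), Nat.cast_sub (by omega)]; simp
    rw [this, abs_of_nonneg]
    · ring
    · have : (i:ℝ) ≤ j := by exact_mod_cast hi.le
      linarith
  | succ d ih =>
    have : (Finset.range (j + (d+1) + 1)).erase j
        = insert (j+d+1) ((Finset.range (j + d + 1)).erase j) := by
      ext x; simp; omega
    rw [this, Finset.prod_insert (by simp), ih, Nat.factorial_succ]
    have : |(j:ℝ) - ((j+d+1 : ℕ):ℝ)| = d + 1 := by
      push_cast
      rw [abs_sub_comm, abs_of_nonneg] <;> [ring; skip]
      have : (0:ℝ) ≤ d := Nat.cast_nonneg d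
      linarith
    rw [this]; push_cast; ring

lemma aux_gap (k : ℕ) (t : ℕ → ℝ) (δ : ℝ) (ht : ∀ i < k, t i + δ ≤ t (i + 1)) (j d : ℕ)
    (h : j + d ≤ k) : d * δ ≤ t (j + d) - t j := by
  induction d with
  | zero => simp
  | succ d ih =>
    have := ih (by omega)
    have h2 := ht (j+d) (by omega)
    push_cast
    rw [← add_assoc]
    linarith

lemma aux_gap_abs (k : ℕ) (t : ℕ → ℝ) (δ : ℝ) (ht : ∀ i < k, t i + δ ≤ t (i + 1)) (i j : ℕ)
    (hi : i ≤ k) (hj : j ≤ k) : δ * |(i:ℝ) - j| ≤ |t i - t j| := by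
  rcases le_total i j with h | h
  · obtain ⟨d, rfl⟩ := Nat.exists_eq_add_of_le h
    have := aux_gap k t δ ht i d hj
    rw [abs_sub_comm (t i), abs_sub_comm (i:ℝ)]
    push_cast
    rw [add_sub_cancel_left, Nat.abs_cast]
    linarith [le_abs_self (t (i+d) - t i)]
  · obtain ⟨d, rfl⟩ := Nat.exists_eq_add_of_le h
    have := aux_gap k t δ ht j d hi
    push_cast
    rw [add_sub_cancel_left, Nat.abs_cast]
    linarith [le_abs_self (t (j+d) - t j)]

lemma aux_points (δ : ℝ) (hδ : 0 < δ) : ∀ (k : ℕ) (F : Set ℝ), BddBelow F →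
    ENNReal.ofReal (k * δ) < volume F →
    ∃ t : ℕ → ℝ, (∀ i ≤ k, t i ∈ F) ∧ ∀ i < k, t i + δ ≤ t (i + 1) := by
  intro k
  induction k with
  | zero =>
    intro F _ hF
    have : F.Nonempty := nonempty_of_measure_ne_zero (ne_bot_of_gt hF)
    obtain ⟨x, hx⟩ := this
    exact ⟨fun _ => x, fun _ _ => hx, by simp⟩
  | succ k ih =>
    intro F hb hF
    have hne : F.Nonempty := nonempty_of_measure_ne_zero (ne_bot_of_gt hF)
    obtain ⟨r, hr0, hr1, hr2⟩ := ENNReal.lt_iff_exists_real_btwn.1 hF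
    have hr : ((k+1 : ℕ):ℝ) * δ < r := by
      by_contra hcon
      exact absurd hr1 (not_lt.2 (ENNReal.ofReal_le_ofReal (not_lt.1 hcon)))
    obtain ⟨x, hx, hxs⟩ := Real.lt_sInf_add_pos hne (sub_pos.2 hr)
    have hsub : F ⊆ Set.Icc (sInf F) (x + δ) ∪ (F ∩ Set.Ici (x + δ)) := by
      intro y hy
      rcases le_total y (x+δ) with h | h
      · exact Or.inl ⟨csInf_le hb hy, h⟩
      · exact Or.inr ⟨hy, h⟩
    have hvol : ENNReal.ofReal (k * δ) < volume (F ∩ Set.Ici (x + δ)) := by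
      by_contra hcon
      have hcon := not_lt.1 hcon
      have h1 := (measure_mono (μ := volume) hsub).trans (measure_union_le _ _)
      rw [Real.volume_Icc] at h1
      have h2 := h1.trans (add_le_add_right hcon _)
      have hle : sInf F ≤ x := csInf_le hb hx
      rw [← ENNReal.ofReal_add (by linarith) (by positivity)] at h2
      refine absurd hr2 (not_lt.2 (h2.trans (ENNReal.ofReal_le_ofReal ?_)))
      push_cast at hxs
      linarith
    obtain ⟨t, ht, htt⟩ := ih _ (hb.mono Set.inter_subset_left) hvol
    refine ⟨fun n => Nat.casesOn n x t, ?_, ?_⟩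
    · intro i hi
      cases i with
      | zero => exact hx
      | succ i => exact (ht i (by omega)).1
    · intro i hi
      cases i with
      | zero => exact (ht 0 (by omega)).2
      | succ i => exact htt i (by omega)

lemma aux_sublevel (k : ℕ) (hk : 1 ≤ k) (I : Set ℝ) (hI : I.OrdConnected)
    (f : ℝ → ℝ) (hf : ContDiffOn ℝ k f I)
    (hderiv : ∀ t ∈ I, 1 ≤ iteratedDerivWithin k f I t)
    (F : Set ℝ) (hFI : F ⊆ I) (l : ℝ) (hl : ∀ x ∈ F, |f x| < l)
    (b : ℝ) (hb : 0 < b) (hbF : ENNReal.ofReal b < volume F) :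
    (b / (2 * k)) ^ k < l := by
  have hk0 : (0:ℝ) < k := by exact_mod_cast hk
  set δ := b / k with hδ
  have hδ0 : 0 < δ := by positivity
  -- restrict to a set bounded below
  obtain ⟨G, hGF, hGb, hG⟩ : ∃ G ⊆ F, BddBelow G ∧ ENNReal.ofReal b < volume G := by
    have hmono : Monotone (fun n : ℕ => F ∩ Set.Ici (-(n:ℝ))) := by
      intro m n hmn x hx
      refine ⟨hx.1, Set.mem_Ici.2 (le_trans ?_ (Set.mem_Ici.1 hx.2))⟩
      have : (m:ℝ) ≤ n := by exact_mod_cast hmn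
      linarith
    have hU : (⋃ n : ℕ, F ∩ Set.Ici (-(n:ℝ))) = F := by
      ext x
      simp only [Set.mem_iUnion, Set.mem_inter_iff, Set.mem_Ici]
      constructor
      · rintro ⟨_, h, _⟩; exact h
      · intro h
        obtain ⟨n, hn⟩ := exists_nat_ge (-x)
        exact ⟨n, h, by linarith⟩
    have h1 := hmono.measure_iUnion (μ := volume)
    rw [hU] at h1
    rw [h1] at hbF
    obtain ⟨n, hn⟩ := lt_iSup_iff.1 hbF
    exact ⟨_, Set.inter_subset_left, ⟨_, fun x hx => hx.2⟩, hn⟩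
  obtain ⟨t, htG, htt⟩ := aux_points δ hδ0 k G hGb (by
    have : (k:ℝ) * δ = b := by rw [hδ]; field_simp
    rwa [this])
  have htI : ∀ i ≤ k, t i ∈ I := fun i hi => hFI (hGF (htG i hi))
  have hlt : ∀ i < k, t i < t (i+1) := fun i hi => by linarith [htt i hi]
  have hu : UniqueDiffOn ℝ I := by
    apply uniqueDiffOn_convex hI.convex
    have hsub : Set.Icc (t 0) (t 1) ⊆ I := hI.out (htI 0 (by omega)) (htI 1 hk)
    refine Set.Nonempty.mono (interior_mono hsub) ?_
    rw [interior_Icc]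
    exact Set.nonempty_Ioo.2 (hlt 0 hk)
  have hgap := aux_gap_abs k t δ htt
  have hinj : Set.InjOn t (Finset.range (k+1)) := by
    intro i hi j hj hij
    have hi : i < k + 1 := by simpa using hi
    have hj : j < k + 1 := by simpa using hj
    have := hgap i j (by omega) (by omega)
    rw [hij, sub_self, abs_zero] at this
    have h2 : |(i:ℝ) - j| ≤ 0 := by
      by_contra hcon
      have := mul_pos hδ0 (not_le.1 hcon)
      linarith
    have h3 := abs_eq_zero.1 (le_antisymm h2 (abs_nonneg _))
    exact_mod_cast sub_eq_zero.1 h3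
  have hmain := aux_divdiff I hI hu k f t hf htI hlt hinj hderiv
  have hterm : ∀ i ∈ Finset.range (k+1),
      f (t i) / ∏ j ∈ (Finset.range (k+1)).erase i, (t i - t j)
        < l / (δ ^ k * (i.factorial * (k - i).factorial)) := by
    intro i hi
    have hik : i ≤ k := by have := Finset.mem_range.1 hi; omega
    have hprod : δ ^ k * (i.factorial * (k - i).factorial) ≤
        |∏ j ∈ (Finset.range (k+1)).erase i, (t i - t j)| := by
      have h1 := aux_prod_s9 i (k - i)
      rw [show i + (k - i) = k by omega] at h1
      have hc : ((Finset.range (k+1)).erase i).card = k := by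
        rw [Finset.card_erase_of_mem hi]; simp
      rw [← h1, Finset.abs_prod]
      calc _ = ∏ j ∈ (Finset.range (k+1)).erase i, (δ * |(i:ℝ) - j|) := by
            rw [Finset.prod_mul_distrib, Finset.prod_const, hc]
        _ ≤ _ := by
          apply Finset.prod_le_prod
          · intro j _; positivity
          · intro j hj
            have := Finset.mem_range.1 (Finset.mem_of_mem_erase hj)
            exact hgap i j hik (by omega)
    have hpos : 0 < δ ^ k * ((i.factorial:ℝ) * (k - i).factorial) := by positivity
    have hfl := hl _ (hGF (htG i hik))
    calc _ ≤ |f (t i) / ∏ j ∈ (Finset.range (k+1)).erase i, (t i - t j)| := le_abs_self _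
      _ = |f (t i)| / |∏ j ∈ (Finset.range (k+1)).erase i, (t i - t j)| := abs_div _ _
      _ ≤ |f (t i)| / (δ ^ k * (i.factorial * (k - i).factorial)) := by
          gcongr
      _ < _ := by gcongr
  have hsum := Finset.sum_lt_sum_of_nonempty (s := Finset.range (k+1)) (by simp) hterm
  have hsum2 : ∑ i ∈ Finset.range (k+1), l / (δ ^ k * ((i.factorial:ℝ) * (k - i).factorial))
      = l / δ ^ k * 2 ^ k / k.factorial := by
    have h2 : ((2:ℝ)) ^ k = ∑ i ∈ Finset.range (k+1), (k.choose i : ℝ) := by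
      exact_mod_cast (Nat.sum_range_choose k).symm
    rw [h2, Finset.mul_sum, Finset.sum_div]
    apply Finset.sum_congr rfl
    intro i hi
    have hik : i ≤ k := by have := Finset.mem_range.1 hi; omega
    rw [Nat.cast_choose ℝ hik]
    field_simp
  rw [hsum2] at hsum
  have hfac : (0:ℝ) < k.factorial := by positivity
  have h5 : 1 < l / δ ^ k * 2 ^ k := by
    have := mul_lt_mul_of_pos_left hsum hfac
    rw [mul_div_cancel₀ _ hfac.ne'] at this
    linarith
  have h6 : b / (2 * k) = δ / 2 := by rw [hδ]; field_simp
  rw [h6, div_pow, div_lt_iff₀ (by positivity)]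
  rw [div_mul_eq_mul_div, lt_div_iff₀ (by positivity)] at h5
  linarith

lemma aux_meas (a : ENNReal) : MeasurableSet {t : ℝ | ENNReal.ofReal (2 * |t|) < a} := by
  apply measurableSet_lt
  · fun_prop
  · fun_prop

lemma aux_vol (a : ENNReal) : volume {t : ℝ | ENNReal.ofReal (2 * |t|) < a} = a := by
  rcases eq_or_ne a ⊤ with rfl | ha
  · have : {t : ℝ | ENNReal.ofReal (2 * |t|) < ⊤} = Set.univ := by
      ext t
      exact ⟨fun _ => trivial, fun _ => ENNReal.ofReal_lt_top⟩
    rw [this, Real.volume_univ]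
  · lift a to NNReal using ha
    have : {t : ℝ | ENNReal.ofReal (2 * |t|) < (a:ENNReal)} = Set.Ioo (-(a/2:ℝ)) (a/2) := by
      ext t
      simp only [Set.mem_ofPred_eq, Set.mem_Ioo]
      rw [← abs_lt, ENNReal.ofReal_lt_coe_iff (by positivity)]
      constructor <;> intro h <;> linarith
    rw [this, Real.volume_Ioo]
    rw [show (a/2 - -(a/2) : ℝ) = a by ring]
    simp

lemma aux_const (k : ℕ) (hk : 1 ≤ k) :
    (2 : ℝ) ^ k * ((((k + 1) / 2 : ℕ).factorial * (k - (k + 1) / 2).factorial : ℕ) : ℝ)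
          / ((k : ℝ) ^ k * ((k : ℝ) + 1) ^ k) / k.factorial ≤ 1 / (k:ℝ) ^ k := by
  have hk0 : (1:ℝ) ≤ k := by exact_mod_cast hk
  have h1 : ((((k + 1) / 2 : ℕ).factorial * (k - (k + 1) / 2).factorial : ℕ) : ℝ)
      ≤ k.factorial := by
    have := Nat.le_of_dvd (Nat.factorial_pos k)
      (Nat.factorial_mul_factorial_dvd_factorial (n := k) (k := (k+1)/2) (by omega))
    exact_mod_cast this
  have h2 : (2:ℝ) ^ k ≤ ((k:ℝ) + 1) ^ k := by gcongr; linarith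
  rw [div_div, div_le_div_iff₀ (by positivity) (by positivity), one_mul]
  calc _ ≤ ((k:ℝ) + 1) ^ k * k.factorial * (k:ℝ) ^ k := by gcongr
    _ = _ := by ring

/-- One-dimensional Steiner symmetrization estimate: the integral of `|f|` over
a measurable set `E ⊆ I` dominates (a constant times) the integral of the
symmetrized monomial `|t|^k / k!` over the symmetric interval of the same
measure as `E`. The constant `c_k = 2^k j₀!(k-j₀)!/(k^k (k+1)^k)`,
`j₀ = ⌊(k+1)/2⌋`, works. -/
theorem stmt_9 (k : ℕ) (hk : 1 ≤ k) (I : Set ℝ) (hI : I.OrdConnected)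
    (f : ℝ → ℝ) (hf : ContDiffOn ℝ k f I)
    (hderiv : ∀ t ∈ I, 1 ≤ iteratedDerivWithin k f I t)
    (E : Set ℝ) (hE : MeasurableSet E) (hEI : E ⊆ I) :
    ENNReal.ofReal ((2 : ℝ) ^ k
          * ((((k + 1) / 2 : ℕ).factorial * (k - (k + 1) / 2).factorial : ℕ) : ℝ)
          / ((k : ℝ) ^ k * ((k : ℝ) + 1) ^ k))
        * ∫⁻ t in {t : ℝ | ENNReal.ofReal (2 * |t|) < volume E},
            ENNReal.ofReal (|t| ^ k / k.factorial)
      ≤ ∫⁻ t in E, ENNReal.ofReal |f t| := by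
  have hconst := aux_const k hk
  have hk0 : (1:ℝ) ≤ k := by exact_mod_cast hk
  set c : ℝ := (2 : ℝ) ^ k
          * ((((k + 1) / 2 : ℕ).factorial * (k - (k + 1) / 2).factorial : ℕ) : ℝ)
          / ((k : ℝ) ^ k * ((k : ℝ) + 1) ^ k) with hc
  have hc0 : 0 ≤ c := by positivity
  rw [← lintegral_const_mul _ (by fun_prop)]
  simp_rw [← ENNReal.ofReal_mul hc0]
  rw [lintegral_eq_lintegral_meas_le _ (Filter.Eventually.of_forall fun t => by
      simp only [Pi.zero_apply]; positivity) (by fun_prop),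
    lintegral_eq_lintegral_meas_le _ (Filter.Eventually.of_forall fun t => abs_nonneg _)
      (((hf.continuousOn.mono hEI).abs).aemeasurable hE)]
  apply setLIntegral_mono' measurableSet_Ioi
  intro l hl
  have hl : 0 < l := hl
  set F : Set ℝ := {x | |f x| < l} ∩ E with hF
  set a := volume F with ha
  have hsub := aux_sublevel k hk I hI f hf hderiv F (fun x hx => hEI hx.2) l (fun x hx => hx.1)
  have hafin : a ≠ ⊤ := by
    intro htop
    have := hsub (2 * k * (l + 1)) (by positivity) (by rw [← ha, htop]; exact ENNReal.ofReal_lt_top)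
    rw [mul_div_cancel_left₀ _ (by positivity)] at this
    have h2 : l + 1 ≤ (l+1)^k := le_self_pow₀ (by linarith) (by omega)
    linarith
  have haE : a ≤ volume E := measure_mono Set.inter_subset_right
  rw [Measure.restrict_apply' (aux_meas _), Measure.restrict_apply' hE]
  have h1 : {t : ℝ | l ≤ c * (|t| ^ k / k.factorial)} ∩ {t | ENNReal.ofReal (2 * |t|) < volume E}
      ⊆ {t | ENNReal.ofReal (2 * |t|) < volume E} \ {t | ENNReal.ofReal (2 * |t|) < a} := by
    rintro t ⟨ht1, ht2⟩
    refine ⟨ht2, fun ht3 => ?_⟩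
    have ht1 : l ≤ c * (|t| ^ k / k.factorial) := ht1
    have ht3 : ENNReal.ofReal (2 * |t|) < a := ht3
    rcases eq_or_ne t 0 with rfl | ht0
    · rw [abs_zero, zero_pow (by omega), zero_div, mul_zero] at ht1
      linarith
    · have h := hsub (2 * |t|) (by positivity) ht3
      rw [mul_div_mul_left _ _ two_ne_zero, div_pow] at h
      have h3 : c * (|t| ^ k / k.factorial) = c / k.factorial * |t| ^ k := by ring
      have h4 : c / k.factorial * |t| ^ k ≤ 1 / (k:ℝ) ^ k * |t| ^ k := by gcongr
      have h5 : 1 / (k:ℝ) ^ k * |t| ^ k = |t| ^ k / (k:ℝ) ^ k := by ring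
      linarith
  refine (measure_mono h1).trans ?_
  have h2 : {t : ℝ | ENNReal.ofReal (2 * |t|) < a} ⊆ {t | ENNReal.ofReal (2 * |t|) < volume E} :=
    fun t ht => lt_of_lt_of_le ht haE
  rw [measure_sdiff h2 (aux_meas _).nullMeasurableSet
    (by rw [aux_vol]; exact hafin), aux_vol, aux_vol, tsub_le_iff_right]
  refine (measure_mono ?_).trans (measure_union_le _ _)
  intro x hx
  rcases le_or_gt l (|f x|) with h | h
  · exact Or.inl ⟨h, hx⟩
  · exact Or.inr ⟨h, hx⟩
end

section
/- Let $T$ be a nonnegative linear operator mapping measurable functions on a $\sigma$-finite measure space $X$ to measurable functions on a $\sigma$-finite measure space $Y$, and let $1 < p, q < \infty$. Suppose there is a constant $C$ such that for every positive integer $N$, every measurable $\mathbf{F} \subset X^N$, and every measurable $\mathbf{G} \subset Y^N$, the $N$-fold tensor product $\mathbf{T}$ of $T$ satisfies $\int_{Y^N} \mathbf{T}(\chi_{\mathbf{F}})(\mathbf{u}) \chi_{\mathbf{G}}(\mathbf{u})\, d\mathbf{u} \leq C^N |\mathbf{F}|^{1/p} |\mathbf{G}|^{1-1/q}$. Then $T$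 is bounded from $L^p(X)$ to $L^q(Y)$, with operator norm at most $4C$. -/
open MeasureTheory ENNReal

lemma aux_prod_dep {X : Type*} [MeasureSpace X] [SigmaFinite (volume : Measure X)] {N : ℕ}
    (f : Fin N → X → ℝ≥0∞) (hf : ∀ i, Measurable (f i)) :
    ∫⁻ x : Fin N → X, ∏ i, f i (x i) = ∏ i, (∫⁻ x, f i x) := by
  induction N with
  | zero => simp [volume_pi]
  | succ n ih =>
    calc _ = ∫⁻ x : X × (Fin n → X), f 0 x.1 * ∏ i : Fin n, f i.succ (x.2 i) := by
          rw [← ((volume_preserving_piFinSuccAbove (fun _ : Fin (n+1) => X) 0).symm).lintegral_comp_emb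
            (MeasurableEquiv.measurableEmbedding _)]
          simp_rw [MeasurableEquiv.piFinSuccAbove_symm_apply, Fin.insertNthEquiv,
            Fin.prod_univ_succ, Fin.insertNth_zero]
          simp
      _ = _ := by
          rw [Measure.volume_eq_prod, lintegral_prod_mul (hf 0).aemeasurable
            (by fun_prop : Measurable fun y : Fin n → X => ∏ i : Fin n, f i.succ (y i)).aemeasurable,
            ih _ (fun i => hf i.succ), Fin.prod_univ_succ]

lemma aux_prod_s15 {X : Type*} [MeasureSpace X] [SigmaFinite (volume : Measure X)]
    (f : X → ℝ≥0∞) (hf : Measurable f) (N : ℕ) :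
    ∫⁻ x : Fin N → X, ∏ i, f (x i) = (∫⁻ x, f x) ^ N := by
  rw [aux_prod_dep (fun _ => f) (fun _ => hf)]
  simp

lemma aux_growth (S D A : ℝ≥0∞) (hA : A ≠ ⊤)
    (h : ∀ N : ℕ, 1 ≤ N → S ^ N ≤ A * (N:ℝ≥0∞) ^ 2 * D ^ N) : S ≤ D := by
  by_contra! hlt
  have hD : D ≠ ⊤ := hlt.ne_top
  have hS : S ≠ ⊤ := by
    rintro rfl
    have := h 1 le_rfl
    simp at this
    exact ENNReal.mul_ne_top hA hD this
  lift S to NNReal using hS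
  lift D to NNReal using hD
  lift A to NNReal using hA
  norm_cast at h hlt
  by_cases hD0 : D = 0
  · subst hD0
    have := h 1 le_rfl
    simp at this
    exact hlt.ne' this
  have hDp : (0:ℝ) < D := by positivity
  have hr : 1 < (S:ℝ) / D := (one_lt_div hDp).2 (by exact_mod_cast hlt)
  have ht := (tendsto_pow_const_div_const_pow_of_one_lt 2 hr).const_mul (A:ℝ)
  rw [mul_zero] at ht
  obtain ⟨N, hN, hN1⟩ := ((ht.eventually (gt_mem_nhds (zero_lt_one))).and
    (Filter.eventually_ge_atTop 1)).exists
  have h1 : (S:ℝ)^N ≤ A * (N:ℝ)^2 * D^N := by exact_mod_cast h N hN1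
  have hSp : (0:ℝ) < S := hDp.trans (by exact_mod_cast hlt)
  rw [← mul_div_assoc, div_lt_one (by positivity), div_pow, lt_div_iff₀ (by positivity)] at hN
  linarith

lemma aux_two {a b : ℕ} (h : a < b) : (2:ℝ≥0∞)^a < 2^b := by
  exact_mod_cast Nat.pow_lt_pow_right (by norm_num) h

/-- dyadic levels -/
lemma aux_level (L : ℕ) (t : ℝ≥0∞) (ht : t = 0 ∨ ((2:ℝ≥0∞) ^ L)⁻¹ ≤ t ∧ t ≤ 2 ^ L) :
    t ≤ ∑ m ∈ Finset.range (2 * L + 1),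
      2 * (2 ^ m * ((2:ℝ≥0∞) ^ L)⁻¹) * {s : ℝ≥0∞ | 2 ^ m * ((2:ℝ≥0∞) ^ L)⁻¹ ≤ s}.indicator
        (fun _ => (1:ℝ≥0∞)) t := by
  rcases ht with rfl | ⟨h1, h2⟩
  · simp
  have hL0 : (2:ℝ≥0∞)^L ≠ 0 := by positivity
  have hLt : (2:ℝ≥0∞)^L ≠ ⊤ := by simp
  have hex : ∃ m, t < 2 ^ (m+1) * ((2:ℝ≥0∞) ^ L)⁻¹ := by
    refine ⟨2 * L, h2.trans_lt ?_⟩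
    rw [← div_eq_mul_inv, ENNReal.lt_div_iff_mul_lt (by simp) (by simp), ← pow_add]
    exact aux_two (by omega)
  classical
  have hm := Nat.find_spec hex
  have hmin := fun k => @Nat.find_min _ _ hex k
  set m := Nat.find hex
  have hle : 2 ^ m * ((2:ℝ≥0∞) ^ L)⁻¹ ≤ t := by
    rcases Nat.eq_zero_or_pos m with h0 | h0
    · simpa [h0] using h1
    · have := hmin (m-1) (by omega)
      rw [Nat.sub_add_cancel h0] at this
      exact not_lt.1 this
  have hmr : m ∈ Finset.range (2*L+1) := by
    rw [Finset.mem_range]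
    by_contra! hc
    have : (2:ℝ≥0∞)^L < 2 ^ m * ((2:ℝ≥0∞) ^ L)⁻¹ := by
      rw [← div_eq_mul_inv, ENNReal.lt_div_iff_mul_lt (by simp) (by simp), ← pow_add]
      exact aux_two (by omega)
    exact absurd (this.trans_le hle) (not_lt.2 h2)
  refine le_trans ?_ (Finset.single_le_sum (fun _ _ => zero_le) hmr)
  rw [Set.indicator_of_mem (by exact hle), mul_one, ← mul_assoc, ← pow_succ']
  exact hm.le

lemma aux_cheb {X : Type*} [MeasureSpace X] (F : X → ℝ≥0∞) (hF : Measurable F) (p : ℝ) (hp : 0 < p)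
    (e : ℝ≥0∞) : e * volume {x | e ≤ F x} ^ (1/p) ≤ (∫⁻ x, F x ^ p) ^ (1/p) := by
  have := mul_meas_ge_le_lintegral (μ := volume) (hF.pow_const p) (e ^ p)
  have h2 : {x | e ^ p ≤ F x ^ p} = {x | e ≤ F x} := by
    ext x; simp [ENNReal.rpow_le_rpow_iff hp]
  rw [h2] at this
  have h3 := ENNReal.rpow_le_rpow this (by positivity : 0 ≤ 1/p)
  rwa [ENNReal.mul_rpow_of_nonneg _ _ (by positivity), ← ENNReal.rpow_mul, mul_one_div_cancel hp.ne',
    ENNReal.rpow_one] at h3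

lemma aux_range {X : Type*} (f : X → ℝ≥0∞) (M : ℕ)
    (hf : ∀ x, f x = 0 ∨ ((2:ℝ≥0∞) ^ M)⁻¹ ≤ f x ∧ f x ≤ 2 ^ M) (N : ℕ) (x : Fin N → X) :
    ∏ i, f (x i) = 0 ∨ ((2:ℝ≥0∞) ^ (M * N))⁻¹ ≤ ∏ i, f (x i) ∧ ∏ i, f (x i) ≤ 2 ^ (M * N) := by
  by_cases h0 : ∃ i, f (x i) = 0
  · obtain ⟨i, hi⟩ := h0
    exact Or.inl (Finset.prod_eq_zero (Finset.mem_univ i) hi)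
  · push Not at h0
    have h1 := fun i => (hf (x i)).resolve_left (h0 i)
    right
    constructor
    · calc ((2:ℝ≥0∞) ^ (M * N))⁻¹ = ∏ i : Fin N, ((2:ℝ≥0∞) ^ M)⁻¹ := by
            simp [pow_mul, ENNReal.inv_pow]
        _ ≤ _ := Finset.prod_le_prod' fun i _ => (h1 i).1
    · calc ∏ i, f (x i) ≤ ∏ i : Fin N, ((2:ℝ≥0∞) ^ M) := Finset.prod_le_prod' fun i _ => (h1 i).2
        _ = _ := by simp [pow_mul]

/-- The estimate for functions with values in a compact dyadic range. -/
lemma aux_trunc {X Y : Type*} [MeasureSpace X] [MeasureSpace Y]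
    [SigmaFinite (volume : Measure X)] [SigmaFinite (volume : Measure Y)]
    (K : Y → X → ℝ≥0∞) (hK : Measurable (Function.uncurry K))
    (p r : ℝ) (hp : 0 < p) (hr : 0 < r) (C : ℝ≥0∞)
    (h : ∀ (N : ℕ) (F : Set (Fin N → X)) (G : Set (Fin N → Y)),
      MeasurableSet F → MeasurableSet G →
      (∫⁻ u in G, ∫⁻ x, (∏ i, K (u i) (x i)) * F.indicator (fun _ => (1 : ℝ≥0∞)) x)
        ≤ C ^ N * (volume F) ^ (1 / p) * (volume G) ^ (1 / r))
    (f : X → ℝ≥0∞) (hfm : Measurable f) (g : Y → ℝ≥0∞) (hgm : Measurable g) (M : ℕ)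
    (hf : ∀ x, f x = 0 ∨ ((2:ℝ≥0∞) ^ M)⁻¹ ≤ f x ∧ f x ≤ 2 ^ M)
    (hg : ∀ x, g x = 0 ∨ ((2:ℝ≥0∞) ^ M)⁻¹ ≤ g x ∧ g x ≤ 2 ^ M) :
    ∫⁻ y, (∫⁻ x, K y x * f x) * g y
      ≤ C * (∫⁻ x, f x ^ p) ^ (1/p) * (∫⁻ y, g y ^ r) ^ (1/r) := by
  apply aux_growth _ _ (4 * (2 * M + 1 : ℝ≥0∞)^2)
    (ENNReal.mul_ne_top (by simp) (ENNReal.pow_ne_top (by finiteness)))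
  intro N hN
  have hKu : ∀ u, Measurable (K u) := fun u => hK.comp measurable_prodMk_left
  have hT : Measurable fun y => ∫⁻ x, K y x * f x := by
    apply Measurable.lintegral_prod_right
    exact hK.mul (hfm.comp measurable_snd)
  have hKN : Measurable fun z : (Fin N → Y) × (Fin N → X) => ∏ i, K (z.1 i) (z.2 i) := by
    refine Finset.measurable_prod _ fun i _ => ?_
    have h2 : Measurable fun z : (Fin N → Y) × (Fin N → X) => (z.1 i, z.2 i) := by fun_prop
    exact hK.comp h2
  have hKNu : ∀ u : Fin N → Y, Measurable fun x : Fin N → X => ∏ i, K (u i) (x i) :=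
    fun u => hKN.comp measurable_prodMk_left
  set Fn : (Fin N → X) → ℝ≥0∞ := fun x => ∏ i, f (x i) with hFn
  set Gn : (Fin N → Y) → ℝ≥0∞ := fun x => ∏ i, g (x i) with hGn
  have hFnm : Measurable Fn := by fun_prop
  have hGnm : Measurable Gn := by fun_prop
  set e : ℕ → ℝ≥0∞ := fun m => 2 ^ m * ((2:ℝ≥0∞) ^ (M * N))⁻¹ with he
  set R := Finset.range (2 * (M * N) + 1) with hR
  set Fs : ℕ → Set (Fin N → X) := fun m => {x | e m ≤ Fn x} with hFs
  set Gs : ℕ → Set (Fin N → Y) := fun m => {x | e m ≤ Gn x} with hGs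
  have hFsm : ∀ m, MeasurableSet (Fs m) := fun m => measurableSet_le measurable_const hFnm
  have hGsm : ∀ m, MeasurableSet (Gs m) := fun m => measurableSet_le measurable_const hGnm
  have hFle : ∀ x, Fn x ≤ ∑ m ∈ R, 2 * e m * (Fs m).indicator (fun _ => (1:ℝ≥0∞)) x :=
    fun x => aux_level (M * N) (Fn x) (aux_range f M hf N x)
  have hGle : ∀ x, Gn x ≤ ∑ m ∈ R, 2 * e m * (Gs m).indicator (fun _ => (1:ℝ≥0∞)) x :=
    fun x => aux_level (M * N) (Gn x) (aux_range g M hg N x)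
  have hFc : ∀ m, e m * volume (Fs m) ^ (1/p) ≤ ((∫⁻ x, f x ^ p) ^ (1/p)) ^ N := by
    intro m
    refine (aux_cheb Fn hFnm p hp (e m)).trans (le_of_eq ?_)
    simp_rw [hFn, ← ENNReal.prod_rpow_of_nonneg hp.le]
    rw [aux_prod_s15 (fun x => f x ^ p) (hfm.pow_const p), ← ENNReal.rpow_natCast, ← ENNReal.rpow_natCast,
      ← ENNReal.rpow_mul, ← ENNReal.rpow_mul, mul_comm]
  have hGc : ∀ m, e m * volume (Gs m) ^ (1/r) ≤ ((∫⁻ x, g x ^ r) ^ (1/r)) ^ N := by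
    intro m
    refine (aux_cheb Gn hGnm r hr (e m)).trans (le_of_eq ?_)
    simp_rw [hGn, ← ENNReal.prod_rpow_of_nonneg hr.le]
    rw [aux_prod_s15 (fun x => g x ^ r) (hgm.pow_const r), ← ENNReal.rpow_natCast, ← ENNReal.rpow_natCast,
      ← ENNReal.rpow_mul, ← ENNReal.rpow_mul, mul_comm]
  set a := (∫⁻ x, f x ^ p) ^ (1/p)
  set b := (∫⁻ x, g x ^ r) ^ (1/r)
  set Q : ℕ → (Fin N → Y) → ℝ≥0∞ := fun m u =>
    ∫⁻ x, (∏ i, K (u i) (x i)) * (Fs m).indicator (fun _ => (1 : ℝ≥0∞)) x with hQ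
  have hQm : ∀ m, Measurable (Q m) := by
    intro m
    apply Measurable.lintegral_prod_right
    exact hKN.mul ((measurable_const.indicator (hFsm m)).comp measurable_snd)
  calc (∫⁻ y, (∫⁻ x, K y x * f x) * g y) ^ N
      = ∫⁻ u : Fin N → Y, ∏ i, ((∫⁻ x, K (u i) x * f x) * g (u i)) :=
        (aux_prod_s15 _ (hT.mul hgm) N).symm
    _ = ∫⁻ u : Fin N → Y, (∫⁻ x, (∏ i, K (u i) (x i)) * Fn x) * Gn u := by
        congr 1; ext u
        rw [Finset.prod_mul_distrib]
        congr 1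
        rw [← aux_prod_dep (fun i x => K (u i) x * f x) (fun i => (hKu _).mul hfm)]
        simp_rw [Finset.prod_mul_distrib, hFn]
    _ ≤ ∫⁻ u : Fin N → Y, ∑ n ∈ R, ∑ m ∈ R, (2 * e m) * (2 * e n) * (Gs n).indicator (Q m) u := by
        refine lintegral_mono fun u => ?_
        have h1 : ∫⁻ x, (∏ i, K (u i) (x i)) * Fn x ≤ ∑ m ∈ R, 2 * e m * Q m u := by
          calc _ ≤ ∫⁻ x, ∑ m ∈ R, 2 * e m * ((∏ i, K (u i) (x i)) *
                  (Fs m).indicator (fun _ => (1 : ℝ≥0∞)) x) := by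
                refine lintegral_mono fun x => ?_
                refine (mul_le_mul_right (hFle x) _).trans (le_of_eq ?_)
                rw [Finset.mul_sum]
                refine Finset.sum_congr rfl fun m _ => by ring
            _ = _ := by
                rw [lintegral_finsetSum]
                · refine Finset.sum_congr rfl fun m _ => ?_
                  rw [lintegral_const_mul]
                  exact (hKNu u).mul (measurable_const.indicator (hFsm m))
                · intro m _
                  exact ((hKNu u).mul (measurable_const.indicator (hFsm m))).const_mul _
        refine (mul_le_mul' h1 (hGle u)).trans (le_of_eq ?_)
        rw [Finset.mul_sum]
        refine Finset.sum_congr rfl fun n _ => ?_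
        rw [Finset.sum_mul]
        refine Finset.sum_congr rfl fun m _ => ?_
        by_cases hu : u ∈ Gs n
        · simp only [Set.indicator_of_mem hu]; ring
        · simp only [Set.indicator_of_notMem hu]; ring
    _ = ∑ n ∈ R, ∑ m ∈ R, (2 * e m) * (2 * e n) * ∫⁻ u in Gs n, Q m u := by
        rw [lintegral_finsetSum]
        · refine Finset.sum_congr rfl fun n _ => ?_
          rw [lintegral_finsetSum]
          · refine Finset.sum_congr rfl fun m _ => ?_
            rw [lintegral_const_mul _ ((hQm m).indicator (hGsm n)), lintegral_indicator (hGsm n)]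
          · intro m _
            exact ((hQm m).indicator (hGsm n)).const_mul _
        · intro n _
          refine Finset.measurable_sum _ fun m _ => ?_
          exact ((hQm m).indicator (hGsm n)).const_mul _
    _ ≤ ∑ n ∈ R, ∑ m ∈ R, 4 * (C * a * b) ^ N := by
        refine Finset.sum_le_sum fun n _ => Finset.sum_le_sum fun m _ => ?_
        calc _ ≤ (2 * e m) * (2 * e n) *
                (C ^ N * (volume (Fs m)) ^ (1 / p) * (volume (Gs n)) ^ (1 / r)) :=
              mul_le_mul_right (h N (Fs m) (Gs n) (hFsm m) (hGsm n)) _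
          _ = 4 * C ^ N * (e m * volume (Fs m) ^ (1/p)) * (e n * volume (Gs n) ^ (1/r)) := by ring
          _ ≤ 4 * C ^ N * a ^ N * b ^ N :=
              mul_le_mul' (mul_le_mul_right (hFc m) _) (hGc n)
          _ = _ := by ring
    _ = 4 * (2 * (M * N) + 1 : ℝ≥0∞)^2 * (C * a * b) ^ N := by
        simp only [Finset.sum_const, hR, Finset.card_range, nsmul_eq_mul]
        push_cast; ring
    _ ≤ 4 * ((2 * M + 1) * N : ℝ≥0∞)^2 * (C * a * b) ^ N := by
        have : (2 * (M * N) + 1 : ℝ≥0∞) ≤ (2 * M + 1) * N := by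
          have : 2 * (M * N) + 1 ≤ (2 * M + 1) * N := by nlinarith
          exact_mod_cast this
        gcongr
    _ = _ := by ring

/-- Dyadic truncation. -/
lemma aux_cut {X : Type*} [MeasurableSpace X] (f : X → ℝ≥0∞) (hf : Measurable f)
    (hfin : ∀ x, f x ≠ ⊤) :
    ∃ φ : ℕ → X → ℝ≥0∞, (∀ M, Measurable (φ M)) ∧ (∀ x, Monotone fun M => φ M x) ∧
      (∀ M x, φ M x ≤ f x) ∧
      (∀ M x, φ M x = 0 ∨ ((2:ℝ≥0∞) ^ M)⁻¹ ≤ φ M x ∧ φ M x ≤ 2 ^ M) ∧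
      ∀ x, ∀ᶠ M in Filter.atTop, φ M x = f x := by
  refine ⟨fun M => {x | ((2:ℝ≥0∞) ^ M)⁻¹ ≤ f x ∧ f x ≤ 2 ^ M}.indicator f, ?_, ?_, ?_, ?_, ?_⟩
  · intro M
    exact hf.indicator ((measurableSet_le measurable_const hf).inter
      (measurableSet_le hf measurable_const))
  · intro x M M' hMM
    refine Set.indicator_le_indicator_of_subset ?_ (fun _ => zero_le) x
    rintro y ⟨h1, h2⟩
    have h3 : (2:ℝ≥0∞)^M ≤ 2^M' := pow_le_pow_right₀ (by norm_num) hMM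
    exact ⟨(ENNReal.inv_le_inv.2 h3).trans h1, h2.trans h3⟩
  · intro M x
    exact Set.indicator_le_self _ _ _
  · intro M x
    by_cases hx : x ∈ {x | ((2:ℝ≥0∞) ^ M)⁻¹ ≤ f x ∧ f x ≤ 2 ^ M}
    · right
      beta_reduce
      rw [Set.indicator_of_mem hx]
      exact hx
    · left
      exact Set.indicator_of_notMem hx _
  · intro x
    by_cases h0 : f x = 0
    · filter_upwards with M
      exact le_antisymm (Set.indicator_le_self _ _ _) (h0 ▸ zero_le)
    have ht : Filter.Tendsto (fun M : ℕ => (2:ℝ≥0∞)^M) Filter.atTop (nhds ⊤) :=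
      ENNReal.tendsto_pow_atTop_nhds_top_iff.2 (by norm_num)
    have hi : (f x)⁻¹ < ⊤ := by simpa [lt_top_iff_ne_top] using h0
    filter_upwards [ht.eventually (lt_mem_nhds (lt_top_iff_ne_top.2 (hfin x))),
      ht.eventually (lt_mem_nhds hi)] with M h1 h2
    refine Set.indicator_of_mem ?_ _
    exact ⟨ENNReal.inv_le_iff_inv_le.1 h2.le, h1.le⟩

lemma aux_bilin {X Y : Type*} [MeasureSpace X] [MeasureSpace Y]
    [SigmaFinite (volume : Measure X)] [SigmaFinite (volume : Measure Y)]
    (K : Y → X → ℝ≥0∞) (hK : Measurable (Function.uncurry K))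
    (p r : ℝ) (hp : 0 < p) (hr : 0 < r) (C : ℝ≥0∞)
    (h : ∀ (N : ℕ) (F : Set (Fin N → X)) (G : Set (Fin N → Y)),
      MeasurableSet F → MeasurableSet G →
      (∫⁻ u in G, ∫⁻ x, (∏ i, K (u i) (x i)) * F.indicator (fun _ => (1 : ℝ≥0∞)) x)
        ≤ C ^ N * (volume F) ^ (1 / p) * (volume G) ^ (1 / r))
    (f : X → ℝ≥0∞) (hfm : Measurable f) (g : Y → ℝ≥0∞) (hgm : Measurable g)
    (hf : ∀ x, f x ≠ ⊤) (hg : ∀ x, g x ≠ ⊤) :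
    ∫⁻ y, (∫⁻ x, K y x * f x) * g y
      ≤ C * (∫⁻ x, f x ^ p) ^ (1/p) * (∫⁻ y, g y ^ r) ^ (1/r) := by
  have key : ∀ (f : X → ℝ≥0∞) (g : Y → ℝ≥0∞), Measurable f → Measurable g →
      ∫⁻ y, (∫⁻ x, K y x * f x) * g y = ∫⁻ z : Y × X, K z.1 z.2 * f z.2 * g z.1 := by
    intro f g hf hg
    have hm : Measurable fun z : Y × X => K z.1 z.2 * f z.2 * g z.1 :=
      (hK.mul (hf.comp measurable_snd)).mul (hg.comp measurable_fst)
    rw [Measure.volume_eq_prod, lintegral_prod _ hm.aemeasurable]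
    congr 1; ext y
    have hm2 : Measurable fun x => K y x * f x := (hK.comp measurable_prodMk_left).mul hf
    exact (lintegral_mul_const (g y) hm2).symm
  obtain ⟨φ, φm, φmono, φle, φr, φt⟩ := aux_cut f hfm hf
  obtain ⟨ψ, ψm, ψmono, ψle, ψr, ψt⟩ := aux_cut g hgm hg
  rw [key f g hfm hgm]
  have hlim := lintegral_tendsto_of_tendsto_of_monotone (μ := (volume : Measure (Y × X)))
    (f := fun M z => K z.1 z.2 * φ M z.2 * ψ M z.1) (F := fun z => K z.1 z.2 * f z.2 * g z.1)
    (fun M => ((hK.mul ((φm M).comp measurable_snd)).mul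
      ((ψm M).comp measurable_fst)).aemeasurable)
    (ae_of_all _ fun z M M' hMM => mul_le_mul' (mul_le_mul_right (φmono _ hMM) _) (ψmono _ hMM))
    (ae_of_all _ fun z => by
      apply tendsto_const_nhds.congr'
      filter_upwards [φt z.2, ψt z.1] with M h1 h2
      rw [h1, h2])
  refine le_of_tendsto' hlim fun M => ?_
  rw [← key _ _ (φm M) (ψm M)]
  refine (aux_trunc K hK p r hp hr C h (φ M) (φm M) (ψ M) (ψm M) M (φr M) (ψr M)).trans ?_
  have h1 : ∫⁻ x, φ M x ^ p ≤ ∫⁻ x, f x ^ p :=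
    lintegral_mono fun x => ENNReal.rpow_le_rpow (φle M x) hp.le
  have h2 : ∫⁻ x, ψ M x ^ r ≤ ∫⁻ x, g x ^ r :=
    lintegral_mono fun x => ENNReal.rpow_le_rpow (ψle M x) hr.le
  gcongr

/-- The converse of Hoelder's inequality. -/
lemma aux_dual {Y : Type*} [MeasureSpace Y] [SigmaFinite (volume : Measure Y)]
    (u : Y → ℝ≥0∞) (hu : Measurable u) (q r : ℝ) (hq : 1 < q) (hr : 1 - 1 / q = 1 / r) (B : ℝ≥0∞)
    (h : ∀ g : Y → ℝ≥0∞, Measurable g → (∀ y, g y ≠ ⊤) →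
      ∫⁻ y, u y * g y ≤ B * (∫⁻ y, g y ^ r) ^ (1/r)) :
    (∫⁻ y, u y ^ q) ^ (1/q) ≤ B := by
  have hq0 : 0 < q := by linarith
  have hqr : (q - 1) * r = q := by
    have : r ≠ 0 := by
      rintro rfl
      have : 1 / q < 1 := by rw [div_lt_one hq0]; exact hq
      simp at hr; simp at this; linarith
    field_simp at hr
    linarith
  set S := spanningSets (volume : Measure Y)
  set v : ℕ → Y → ℝ≥0∞ := fun M => (S M).indicator fun y => min (u y) M with hv
  have hvm : ∀ M, Measurable (v M) := fun M =>
    (hu.min measurable_const).indicator (measurableSet_spanningSets _ M)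
  have hvu : ∀ M y, v M y ≤ u y := fun M y =>
    (Set.indicator_le_self _ _ _).trans (min_le_left _ _)
  have hvM : ∀ M y, v M y ≤ M := fun M y =>
    (Set.indicator_le_self _ _ _).trans (min_le_right _ _)
  have hvt : ∀ M y, v M y ≠ ⊤ := fun M y => ((hvM M y).trans_lt (by simp)).ne
  have hlim : Filter.Tendsto (fun M => ∫⁻ y, v M y ^ q) Filter.atTop (nhds (∫⁻ y, u y ^ q)) := by
    refine lintegral_tendsto_of_tendsto_of_monotone (fun M => ((hvm M).pow_const q).aemeasurable)
      (ae_of_all _ fun y M M' hMM => ?_) (ae_of_all _ fun y => ?_)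
    · refine ENNReal.rpow_le_rpow ?_ hq0.le
      refine (Set.indicator_le_indicator_of_subset (f := fun y => min (u y) (M:ℝ≥0∞))
        (monotone_spanningSets volume hMM) (fun _ => zero_le) y).trans
        (Set.indicator_le_indicator ?_)
      exact min_le_min_left _ (by exact_mod_cast hMM)
    · apply (ENNReal.continuous_rpow_const.tendsto _).comp
      have h1 : Filter.Tendsto (fun M : ℕ => min (u y) (M:ℝ≥0∞)) Filter.atTop (nhds (u y)) := by
        have := (tendsto_const_nhds (x := u y)).min ENNReal.tendsto_nat_nhds_top
        simpa using this
      refine h1.congr' ?_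
      have hy : y ∈ ⋃ i, S i := by rw [iUnion_spanningSets]; trivial
      obtain ⟨i, hi⟩ := Set.mem_iUnion.1 hy
      filter_upwards [Filter.eventually_ge_atTop i] with M hM
      have hyM : y ∈ S M := monotone_spanningSets _ hM hi
      simp only [hv, Set.indicator_of_mem hyM]
  have hlim2 := (ENNReal.continuous_rpow_const (y := 1/q)).continuousAt.tendsto.comp hlim
  refine le_of_tendsto' hlim2 fun M => ?_
  simp only [Function.comp]
  set I := ∫⁻ y, v M y ^ q with hI
  have hIfin : I ≠ ⊤ := by
    have : I ≤ ∫⁻ y in S M, (M:ℝ≥0∞) ^ q := by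
      rw [← lintegral_indicator (measurableSet_spanningSets _ M)]
      refine lintegral_mono fun y => ?_
      by_cases hy : y ∈ S M
      · rw [Set.indicator_of_mem hy]
        exact ENNReal.rpow_le_rpow (hvM M y) hq0.le
      · rw [Set.indicator_of_notMem hy]
        simp [hv, Set.indicator_of_notMem hy, hq0]
    refine (this.trans_lt ?_).ne
    rw [setLIntegral_const]
    exact ENNReal.mul_lt_top (ENNReal.rpow_lt_top_of_nonneg hq0.le (by simp))
      (measure_spanningSets_lt_top _ M)
  by_cases hI0 : I = 0
  · rw [hI0, ENNReal.zero_rpow_of_pos (by positivity)]; exact zero_le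
  have hmain := h (fun y => v M y ^ (q - 1)) ((hvm M).pow_const _)
    (fun y => ENNReal.rpow_ne_top_of_nonneg (by linarith) (hvt M y))
  simp_rw [← ENNReal.rpow_mul, hqr] at hmain
  rw [← hI, ← hr] at hmain
  have h2 : I ≤ ∫⁻ y, u y * v M y ^ (q - 1) := by
    refine lintegral_mono fun y => ?_
    calc v M y ^ q = v M y ^ (1 + (q - 1)) := by congr 1; ring
      _ = v M y * v M y ^ (q - 1) := by
          rw [ENNReal.rpow_add_of_nonneg _ _ (by norm_num) (by linarith), ENNReal.rpow_one]
      _ ≤ _ := mul_le_mul_left (hvu M y) _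
  have h3 := h2.trans hmain
  have h4 : I = I ^ (1/q) * I ^ (1 - 1/q) := by
    rw [← ENNReal.rpow_add _ _ hI0 hIfin]; simp
  nth_rw 1 [h4] at h3
  refine (ENNReal.mul_le_mul_iff_left ?_ ?_).1 h3
  · exact (ENNReal.rpow_pos (pos_iff_ne_zero.2 hI0) hIfin).ne'
  · exact ENNReal.rpow_ne_top_of_ne_zero hI0 hIfin

/-- Strong-type bounds from tensored restricted weak-type bounds: if the
`N`-fold tensor powers of a nonnegative kernel operator `T` satisfy uniform
restricted estimates with constant `C^N`, then `T` maps `L^p` to `L^q` with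
norm at most `4C`. -/
theorem stmt_15 (X Y : Type*) [MeasureSpace X] [MeasureSpace Y]
    [SigmaFinite (volume : Measure X)] [SigmaFinite (volume : Measure Y)]
    (K : Y → X → ℝ≥0∞) (hK : Measurable (Function.uncurry K))
    (p q : ℝ) (hp : 1 < p) (hq : 1 < q) (C : ℝ≥0∞) (hC : C < ⊤)
    (h : ∀ (N : ℕ) (F : Set (Fin N → X)) (G : Set (Fin N → Y)),
      MeasurableSet F → MeasurableSet G →
      (∫⁻ u in G, ∫⁻ x, (∏ i, K (u i) (x i)) * F.indicator (fun _ => (1 : ℝ≥0∞)) x)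
        ≤ C ^ N * (volume F) ^ (1 / p) * (volume G) ^ (1 - 1 / q)) :
    ∀ f : X → ℝ≥0∞, Measurable f →
      (∫⁻ y, (∫⁻ x, K y x * f x) ^ q) ^ (1 / q)
        ≤ 4 * C * (∫⁻ x, (f x) ^ p) ^ (1 / p) := by
  intro f hf
  have hp0 : 0 < p := by linarith
  have hq0 : 0 < q := by linarith
  have hq1 : 1 / q < 1 := by rw [div_lt_one hq0]; exact hq
  obtain ⟨r, hr0, hr⟩ : ∃ r : ℝ, 0 < r ∧ 1 - 1 / q = 1 / r :=
    ⟨1 / (1 - 1 / q), by apply one_div_pos.2; linarith, by rw [one_div_one_div]⟩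
  rw [hr] at h
  have hT : ∀ f : X → ℝ≥0∞, Measurable f → Measurable fun y => ∫⁻ x, K y x * f x := by
    intro f hf
    apply Measurable.lintegral_prod_right
    exact hK.mul (hf.comp measurable_snd)
  by_cases hC0 : C = 0
  · subst hC0
    have h1 := aux_bilin K hK p r hp0 hr0 0 h (fun _ => 1) measurable_const (fun _ => 1)
      measurable_const (by simp) (by simp)
    simp only [mul_one, zero_mul, nonpos_iff_eq_zero] at h1
    rw [lintegral_eq_zero_iff (by simpa using hT (fun _ => 1) measurable_const)] at h1
    have h2 : ∫⁻ y, (∫⁻ x, K y x * f x) ^ q = 0 := by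
      rw [lintegral_eq_zero_iff ((hT f hf).pow_const q)]
      filter_upwards [h1] with y hy
      have hKy : Measurable (K y) := hK.comp measurable_prodMk_left
      simp only [Pi.zero_apply] at hy ⊢
      rw [lintegral_eq_zero_iff hKy] at hy
      have : ∫⁻ x, K y x * f x = 0 := by
        have hm : Measurable fun x => K y x * f x := hKy.mul hf
        rw [lintegral_eq_zero_iff hm]
        filter_upwards [hy] with x hx
        simp only [Pi.zero_apply] at hx ⊢
        rw [hx, zero_mul]
      rw [this, ENNReal.zero_rpow_of_pos hq0]
    rw [h2, ENNReal.zero_rpow_of_pos (by positivity)]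
    exact zero_le
  by_cases hfin : ∫⁻ x, f x ^ p = ⊤
  · rw [hfin, ENNReal.top_rpow_of_pos (by positivity), ENNReal.mul_top (by simpa using hC0)]
    exact le_top
  set f' : X → ℝ≥0∞ := {x | f x < ⊤}.indicator f with hf'
  have hf'm : Measurable f' := hf.indicator (measurableSet_lt hf measurable_const)
  have hae : f =ᵐ[volume] f' := by
    filter_upwards [ae_lt_top (hf.pow_const p) hfin] with x hx
    have : f x < ⊤ := by
      rw [lt_top_iff_ne_top]
      intro hx'
      rw [hx', ENNReal.top_rpow_of_pos hp0] at hx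
      exact lt_irrefl _ hx
    exact (Set.indicator_of_mem (by exact this) f).symm
  have hf't : ∀ x, f' x ≠ ⊤ := by
    intro x
    by_cases hx : f x < ⊤
    · rw [hf', Set.indicator_of_mem (by exact hx)]; exact hx.ne
    · rw [hf', Set.indicator_of_notMem (by exact hx)]; simp
  have e1 : ∀ y, ∫⁻ x, K y x * f x = ∫⁻ x, K y x * f' x := fun y =>
    lintegral_congr_ae (by filter_upwards [hae] with x hx; rw [hx])
  have e2 : ∫⁻ x, f x ^ p = ∫⁻ x, f' x ^ p :=
    lintegral_congr_ae (by filter_upwards [hae] with x hx; rw [hx])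
  simp_rw [e1]
  rw [e2]
  refine (aux_dual _ (hT f' hf'm) q r hq hr (C * (∫⁻ x, f' x ^ p) ^ (1/p)) fun g hg hgt =>
    aux_bilin K hK p r hp0 hr0 C h f' hf'm g hg hf't hgt).trans ?_
  rw [mul_assoc]
  exact le_mul_of_one_le_left zero_le (by norm_num)
end
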